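/- arXiv:2510.24621 — 3 statements merged into one kernel-verified Lean document; each statement's English description precedes it below -/
import Mathlib

section
/- Let ε ∈ (0, 1/2) be real and let n > m ≥ 1 be integers such that n − m is even and n − m ≤ (m − 1)/2. Then there exists a dataset p : {1, …, n} → ℝ (points may coincide) such that every ε-coreset of this dataset for the robust geometric median problem with m outliers has size at least m / (2(n − m) + 1). -/
open Finset
open scoped Classical

/-- Robust cost with `m` outliers of a center `c` for a dataset `p : Fin n → ℝ`:
the minimum over index sets `L` of size `m` of the sum of distances of the
remaining points to `c`. -/
noncomputable def rcostIdx {n : ℕ} (m : ℕ) (p : Fin n → ℝ) (c : ℝ) : ℝ :=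
  sInf {y : ℝ | ∃ L : Finset (Fin n), L.card = m ∧ y = ∑ i ∈ Lᶜ, |p i - c|}

/-- Weighted robust cost: minimum of `∑ w' i * |p i - c|` over weight functions
`0 ≤ w' ≤ w` of total weight `t` (here `t = n - m`). -/
noncomputable def wrcostIdx {n : ℕ} (t : ℝ) (w : Fin n → ℝ) (p : Fin n → ℝ) (c : ℝ) : ℝ :=
  sInf {y : ℝ | ∃ w' : Fin n → ℝ, (∀ i, 0 ≤ w' i ∧ w' i ≤ w i) ∧
    (∑ i, w' i) = t ∧ y = ∑ i, w' i * |p i - c|}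

lemma rcostIdx_nonpos {n m : ℕ} {p : Fin n → ℝ} {c : ℝ} (S : Finset (Fin n))
    (hS : S.card + m = n) (hp : ∀ i ∈ S, p i = c) : rcostIdx m p c ≤ 0 := by
  refine csInf_le ⟨0, ?_⟩ ⟨Sᶜ, ?_, ?_⟩
  · rintro y ⟨L, -, rfl⟩
    exact Finset.sum_nonneg fun i _ => abs_nonneg _
  · rw [Finset.card_compl, Fintype.card_fin]
    omega
  · rw [compl_compl]
    exact (Finset.sum_eq_zero fun i hi => by simp [hp i hi]).symm

/-- If all the weight lies at distance at least `1` from the center, then the weighted robust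
cost is at least the total weight that has to be kept. -/
lemma le_wrcostIdx {n : ℕ} {t : ℝ} {w p : Fin n → ℝ} {c : ℝ} (ht : 0 ≤ t)
    (hw : ∀ i, 0 ≤ w i) (htw : t ≤ ∑ i, w i) (hpos : 0 < ∑ i, w i)
    (hfar : ∀ i, 0 < w i → 1 ≤ |p i - c|) : t ≤ wrcostIdx t w p c := by
  refine le_csInf ⟨_, fun i => t / (∑ i, w i) * w i, fun i => ⟨?_, ?_⟩, ?_, rfl⟩ ?_
  · exact mul_nonneg (div_nonneg ht hpos.le) (hw i)
  · exact mul_le_of_le_one_left (hw i) ((div_le_one hpos).2 htw)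
  · rw [← Finset.mul_sum, div_mul_cancel₀ _ hpos.ne']
  · rintro y ⟨w', hw', hsum, rfl⟩
    rw [← hsum]
    refine Finset.sum_le_sum fun i _ => ?_
    rcases (hw i).eq_or_lt with h | h
    · have : w' i = 0 := le_antisymm (h ▸ (hw' i).2) (hw' i).1
      simp [this]
    · exact le_mul_of_one_le_right (hw' i).1 (hfar i h)

lemma card_filter_div_eq {n k j : ℕ} (hk : 0 < k) (hj : j < n / k) :
    (Finset.univ.filter fun i : Fin n => (i : ℕ) / k = j).card = k := by
  have hjn : (j + 1) * k ≤ n := (Nat.le_div_iff_mul_le hk).1 hj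
  have h : (Finset.univ.filter fun i : Fin n => (i : ℕ) / k = j).map Fin.valEmbedding =
      Finset.Ico (j * k) ((j + 1) * k) := by
    ext x
    simp only [Finset.mem_map, Finset.mem_filter, Finset.mem_univ, true_and,
      Fin.valEmbedding_apply, Finset.mem_Ico]
    constructor
    · rintro ⟨i, hi, rfl⟩
      exact ⟨(Nat.le_div_iff_mul_le hk).1 hi.ge,
        (Nat.div_lt_iff_lt_mul hk).1 (hi.trans_lt j.lt_succ_self)⟩
    · intro hx
      exact ⟨⟨x, hx.2.trans_le hjn⟩, le_antisymm
        (Nat.lt_succ_iff.1 ((Nat.div_lt_iff_lt_mul hk).2 hx.2))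
        ((Nat.le_div_iff_mul_le hk).2 hx.1), rfl⟩
  rw [← Finset.card_map Fin.valEmbedding, h, Nat.card_Ico, Nat.succ_mul, Nat.add_sub_cancel_left]

/-- **Coreset lower bound for robust geometric median.**
For `ε ∈ (0, 1/2)`, `n > m ≥ 1` with `n - m` even and `n - m ≤ (m-1)/2`
(equivalently `2(n-m) ≤ m-1`), there is a dataset `p : Fin n → ℝ` such that any
`ε`-coreset (a weight function `w ≥ 0` of total weight `n` whose weighted robust
cost is within a factor `1 ± ε` of the robust cost for every center `c`) has at
least `m / (2(n-m)+1)` indices of positive weight. -/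
theorem robust_median_coreset_lower_bound
    (n m : ℕ) (ε : ℝ) (hm : 1 ≤ m) (hmn : m < n)
    (heven : Even (n - m)) (hsmall : 2 * (n - m) ≤ m - 1)
    (hε0 : 0 < ε) (hε : ε < 1 / 2) :
    ∃ p : Fin n → ℝ,
      ∀ w : Fin n → ℝ,
        (∀ i, 0 ≤ w i) →
        (∑ i, w i) = (n : ℝ) →
        (∀ c : ℝ,
          (1 - ε) * rcostIdx m p c ≤ wrcostIdx ((n : ℝ) - m) w p c ∧
          wrcostIdx ((n : ℝ) - m) w p c ≤ (1 + ε) * rcostIdx m p c) →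
        (m : ℝ) / (2 * ((n : ℝ) - m) + 1) ≤
          ((Finset.univ.filter (fun i => 0 < w i)).card : ℝ) := by
  obtain ⟨k, rfl⟩ := Nat.exists_eq_add_of_lt hmn
  set K := k + 1 with hK
  have hKpos : 0 < K := k.succ_pos
  refine ⟨fun i => ((i / K : ℕ) : ℝ), fun w hw hsum hcore => ?_⟩
  have htK : ((m + k + 1 : ℕ) : ℝ) - m = K := by rw [hK]; push_cast; ring
  have hhit : ∀ j < (m + k + 1) / K, ∃ i : Fin (m + k + 1), 0 < w i ∧ (i : ℕ) / K = j := by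
    intro j hj
    by_contra! hne
    have hcost := rcostIdx_nonpos (m := m) (p := fun i : Fin (m + k + 1) => ((i / K : ℕ) : ℝ))
      (c := (j : ℝ)) (Finset.univ.filter fun i : Fin (m + k + 1) => (i : ℕ) / K = j)
      (by rw [card_filter_div_eq hKpos hj]; omega)
      (fun i hi => by simpa using (Finset.mem_filter.1 hi).2)
    have hfar := le_wrcostIdx (t := (K : ℝ)) (p := fun i : Fin (m + k + 1) => ((i / K : ℕ) : ℝ))
      (c := (j : ℝ)) (Nat.cast_nonneg K) hw
      (by rw [hsum]; exact_mod_cast (by omega : K ≤ m + k + 1))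
      (by rw [hsum]; positivity)
      (fun i hi => by
        have h : ((i / K : ℕ) : ℤ) - j ≠ 0 := sub_ne_zero.2 (by exact_mod_cast hne i hi)
        exact_mod_cast Int.one_le_abs h)
    have hup := (hcore j).2
    rw [htK] at hup
    have hKR : (0 : ℝ) < K := by exact_mod_cast hKpos
    have := mul_nonpos_of_nonneg_of_nonpos (by linarith : 0 ≤ 1 + ε) hcost
    linarith
  have hcard : (m + k + 1) / K ≤ (Finset.univ.filter fun i => 0 < w i).card := by
    rw [← Finset.card_range ((m + k + 1) / K)]
    refine Finset.card_le_card_of_surjOn (fun i : Fin (m + k + 1) => (i : ℕ) / K) fun j hj => ?_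
    obtain ⟨i, hi, hij⟩ := hhit j (by simpa using hj)
    exact ⟨i, by simpa using hi, hij⟩
  have hfloor : m ≤ (Finset.univ.filter fun i => 0 < w i).card * (2 * K + 1) := by
    have := Nat.lt_mul_div_succ (m + k + 1) hKpos
    nlinarith
  rw [htK, div_le_iff₀ (by positivity)]
  exact_mod_cast hfloor
end

section
/- There is an absolute constant C > 0 with the following property. For all integers n, m with n ≥ 4m ≥ 4 and every real ε ∈ (0,1), every set P = {p_1 < p_2 < ⋯ < p_n} of n real numbers admits an ε-coreset for the robust geometric median problem with m outliers of size at most C·(ε^{−1/2} + (m/n)·ε^{−1})·(1 + log(1/ε))^C. -/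
open Finset
open scoped Classical

/-- Robust cost with `m` outliers of a center `c` for a finite set `P ⊂ ℝ`:
the minimum over subsets `L ⊆ P` with `|L| = m` of `∑_{p ∈ P \ L} |p - c|`. -/
noncomputable def rcost (m : ℕ) (P : Finset ℝ) (c : ℝ) : ℝ :=
  sInf {y : ℝ | ∃ L : Finset ℝ, L ⊆ P ∧ L.card = m ∧ y = ∑ p ∈ P \ L, |p - c|}

/-- Weighted robust cost of a weighted finite set `(S, w)`: the minimum of
`∑ w'(p) * |p - c|` over weight functions `0 ≤ w' ≤ w` on `S` of total weight `t`
(here `t = n - m`). -/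
noncomputable def wrcost (t : ℝ) (S : Finset ℝ) (w : ℝ → ℝ) (c : ℝ) : ℝ :=
  sInf {y : ℝ | ∃ w' : ℝ → ℝ, (∀ p ∈ S, 0 ≤ w' p ∧ w' p ≤ w p) ∧
    (∑ p ∈ S, w' p) = t ∧ y = ∑ p ∈ S, w' p * |p - c|}

/-- `τ` is the `k`-th smallest value of `d` on `P`, counted with multiplicity. -/
def IsLevel (P : Finset ℝ) (d : ℝ → ℝ) (k : ℕ) (τ : ℝ) : Prop :=
  (P.filter fun p => d p < τ).card < k ∧ k ≤ (P.filter fun p => d p ≤ τ).card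

theorem exists_isLevel {P : Finset ℝ} (d : ℝ → ℝ) {k : ℕ} (hk : 1 ≤ k) (hkP : k ≤ P.card) :
    ∃ τ, IsLevel P d k τ := by
  have hne : (P.filter fun q => k ≤ (P.filter fun p => d p ≤ d q).card).Nonempty := by
    have hP : P.Nonempty := Finset.card_pos.mp (by omega)
    obtain ⟨q, hq, hmax⟩ := Finset.exists_max_image P d hP
    refine ⟨q, Finset.mem_filter.mpr ⟨hq, ?_⟩⟩
    rwa [Finset.filter_true_of_mem hmax]
  obtain ⟨q, hq, hmin⟩ := Finset.exists_min_image _ d hne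
  refine ⟨d q, ?_, (Finset.mem_filter.mp hq).2⟩
  by_contra! hcon
  have hne' : (P.filter fun p => d p < d q).Nonempty := Finset.card_pos.mp (by omega)
  obtain ⟨x, hx, hmax⟩ := Finset.exists_max_image _ d hne'
  rw [Finset.mem_filter] at hx
  have : d q ≤ d x := by
    refine hmin x (Finset.mem_filter.mpr ⟨hx.1, hcon.trans (Finset.card_le_card ?_)⟩)
    intro y hy
    exact Finset.mem_filter.mpr ⟨(Finset.mem_filter.mp hy).1, hmax y hy⟩
  linarith [hx.2]

theorem IsLevel.le_add {P : Finset ℝ} {d d' : ℝ → ℝ} {k : ℕ} {τ τ' R : ℝ}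
    (h : IsLevel P d k τ) (h' : IsLevel P d' k τ') (hR : ∀ p ∈ P, d' p ≤ d p + R) :
    τ' ≤ τ + R := by
  by_contra! hlt
  have hsub : (P.filter fun p => d p ≤ τ) ⊆ P.filter fun p => d' p < τ' := by
    intro p hp
    rw [Finset.mem_filter] at hp ⊢
    exact ⟨hp.1, by linarith [hR p hp.1, hp.2]⟩
  have := Finset.card_le_card hsub
  have := h.2
  have := h'.1
  omega

theorem IsLevel.nonneg {P : Finset ℝ} {d : ℝ → ℝ} {k : ℕ} {τ : ℝ} (h : IsLevel P d k τ)
    (hd : ∀ p, 0 ≤ d p) : 0 ≤ τ := by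
  have hpos : 0 < (P.filter fun p => d p ≤ τ).card := by
    have := h.1
    have := h.2
    omega
  obtain ⟨p, hp⟩ := Finset.card_pos.mp hpos
  exact (hd p).trans (Finset.mem_filter.mp hp).2

theorem IsLevel.exists_subset {P : Finset ℝ} {d : ℝ → ℝ} {k : ℕ} {τ : ℝ} (h : IsLevel P d k τ) :
    ∃ I ⊆ P, I.card = k ∧ (∀ p ∈ P, d p < τ → p ∈ I) ∧
      ∑ p ∈ I, d p = k * τ - ∑ p ∈ P, max (τ - d p) 0 := by
  have hsub : (P.filter fun p => d p < τ) ⊆ P.filter fun p => d p ≤ τ := by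
    intro p hp
    rw [Finset.mem_filter] at hp ⊢
    exact ⟨hp.1, hp.2.le⟩
  obtain ⟨I, hI₁, hI₂, hI⟩ := Finset.exists_subsuperset_card_eq hsub h.1.le h.2
  have hIP : I ⊆ P := hI₂.trans (Finset.filter_subset _ _)
  have hin : ∀ p ∈ P, d p < τ → p ∈ I := fun p hp hlt => hI₁ (Finset.mem_filter.mpr ⟨hp, hlt⟩)
  refine ⟨I, hIP, hI, hin, ?_⟩
  have hrest : ∑ p ∈ I, max (τ - d p) 0 = ∑ p ∈ P, max (τ - d p) 0 := by
    refine Finset.sum_subset hIP fun p hp hpI => ?_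
    have : τ ≤ d p := not_lt.mp fun hlt => hpI (hin p hp hlt)
    exact max_eq_right (by linarith)
  rw [← hrest, eq_sub_iff_add_eq, ← Finset.sum_add_distrib, ← hI, ← nsmul_eq_mul,
    ← Finset.sum_const]
  refine Finset.sum_congr rfl fun p hp => ?_
  have := (Finset.mem_filter.mp (hI₂ hp)).2
  rw [max_eq_left (by linarith)]
  ring

theorem rcost_le {m : ℕ} {P I : Finset ℝ} {c : ℝ} (hI : I ⊆ P) (hcard : I.card + m = P.card) :
    rcost m P c ≤ ∑ p ∈ I, |p - c| := by
  refine csInf_le ⟨0, ?_⟩ ⟨P \ I, Finset.sdiff_subset, ?_, ?_⟩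
  · rintro y ⟨L, -, -, rfl⟩
    exact Finset.sum_nonneg fun p _ => abs_nonneg _
  · rw [Finset.card_sdiff_of_subset hI]
    omega
  · rw [Finset.sdiff_sdiff_eq_self hI]

theorem le_rcost {m : ℕ} {P : Finset ℝ} {c x : ℝ} (hm : m ≤ P.card)
    (h : ∀ I ⊆ P, I.card + m = P.card → x ≤ ∑ p ∈ I, |p - c|) : x ≤ rcost m P c := by
  refine le_csInf ?_ ?_
  · obtain ⟨L, hL, hcard⟩ := Finset.exists_subset_card_eq hm
    exact ⟨_, L, hL, hcard, rfl⟩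
  · rintro y ⟨L, hL, hcard, rfl⟩
    refine h _ Finset.sdiff_subset ?_
    rw [Finset.card_sdiff_of_subset hL]
    omega

theorem dual_le_rcost {m : ℕ} {P : Finset ℝ} (hm : m ≤ P.card) (c τ : ℝ) :
    ((P.card : ℝ) - m) * τ - ∑ p ∈ P, max (τ - |p - c|) 0 ≤ rcost m P c := by
  refine le_rcost hm fun I hI hcard => ?_
  have h₁ : ∑ p ∈ I, max (τ - |p - c|) 0 ≤ ∑ p ∈ P, max (τ - |p - c|) 0 :=
    Finset.sum_le_sum_of_subset_of_nonneg hI fun _ _ _ => le_max_right _ _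
  have h₂ : ∑ p ∈ I, τ ≤ ∑ p ∈ I, (|p - c| + max (τ - |p - c|) 0) :=
    Finset.sum_le_sum fun p _ => by linarith [le_max_left (τ - |p - c|) 0]
  rw [Finset.sum_const, nsmul_eq_mul, Finset.sum_add_distrib] at h₂
  have h₃ : (I.card : ℝ) = P.card - m := by
    rw [← hcard]
    push_cast
    ring
  rw [h₃] at h₂
  linarith

theorem IsLevel.rcost_le {m : ℕ} {P : Finset ℝ} (hm : m ≤ P.card) {c τ : ℝ}
    (h : IsLevel P (fun p => |p - c|) (P.card - m) τ) :
    rcost m P c ≤ ((P.card : ℝ) - m) * τ - ∑ p ∈ P, max (τ - |p - c|) 0 := by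
  obtain ⟨I, hI, hcard, -, hsum⟩ := h.exists_subset
  rw [Nat.cast_sub hm] at hsum
  rw [← hsum]
  exact _root_.rcost_le hI (by omega)

/-- The weights of the image of the counting measure on `P` under `f`. -/
noncomputable def pushWeight (P : Finset ℝ) (f : ℝ → ℝ) (s : ℝ) : ℝ :=
  ((P.filter fun p => f p = s).card : ℝ)

theorem sum_pushWeight_mul (P I : Finset ℝ) (hI : I ⊆ P) (f φ : ℝ → ℝ) :
    ∑ s ∈ P.image f, pushWeight I f s * φ s = ∑ p ∈ I, φ (f p) := by
  rw [← Finset.sum_fiberwise_of_maps_to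
    (fun p hp => Finset.mem_image_of_mem f (hI hp) : ∀ p ∈ I, f p ∈ P.image f)]
  refine Finset.sum_congr rfl fun s _ => ?_
  rw [pushWeight, ← nsmul_eq_mul, ← Finset.sum_const]
  exact Finset.sum_congr rfl fun p hp => by rw [(Finset.mem_filter.mp hp).2]

theorem sum_pushWeight (P I : Finset ℝ) (hI : I ⊆ P) (f : ℝ → ℝ) :
    ∑ s ∈ P.image f, pushWeight I f s = I.card := by
  simpa using sum_pushWeight_mul P I hI f fun _ => 1

theorem pushWeight_mono {P I : Finset ℝ} (hI : I ⊆ P) (f : ℝ → ℝ) (s : ℝ) :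
    pushWeight I f s ≤ pushWeight P f s :=
  Nat.cast_le.mpr (Finset.card_le_card (Finset.filter_subset_filter _ hI))

theorem wrcost_pushWeight_le {m : ℕ} {P I : Finset ℝ} {f : ℝ → ℝ} {c : ℝ} (hI : I ⊆ P)
    (hcard : I.card + m = P.card) :
    wrcost ((P.card : ℝ) - m) (P.image f) (pushWeight P f) c ≤ ∑ p ∈ I, |f p - c| := by
  refine csInf_le ⟨0, ?_⟩ ⟨pushWeight I f, ?_, ?_, ?_⟩
  · rintro y ⟨w', hw', -, rfl⟩
    exact Finset.sum_nonneg fun p hp => mul_nonneg (hw' p hp).1 (abs_nonneg _)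
  · exact fun p _ => ⟨Nat.cast_nonneg _, pushWeight_mono hI f p⟩
  · rw [sum_pushWeight P I hI, ← hcard]
    push_cast
    ring
  · exact (sum_pushWeight_mul P I hI f fun s => |s - c|).symm

theorem IsLevel.wrcost_le {m : ℕ} {P : Finset ℝ} (hm : m ≤ P.card) {f : ℝ → ℝ} {c τ : ℝ}
    (h : IsLevel P (fun p => |f p - c|) (P.card - m) τ) :
    wrcost ((P.card : ℝ) - m) (P.image f) (pushWeight P f) c ≤
      ((P.card : ℝ) - m) * τ - ∑ p ∈ P, max (τ - |f p - c|) 0 := by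
  obtain ⟨I, hI, hcard, -, hsum⟩ := h.exists_subset
  rw [Nat.cast_sub hm] at hsum
  rw [← hsum]
  exact wrcost_pushWeight_le hI (by omega)

theorem dual_le_wrcost {m : ℕ} {P : Finset ℝ} (hm : m ≤ P.card) (f : ℝ → ℝ) (c τ : ℝ) :
    ((P.card : ℝ) - m) * τ - ∑ p ∈ P, max (τ - |f p - c|) 0 ≤
      wrcost ((P.card : ℝ) - m) (P.image f) (pushWeight P f) c := by
  refine le_csInf ?_ ?_
  · obtain ⟨I, hI, hcard⟩ := Finset.exists_subset_card_eq (Nat.sub_le P.card m)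
    refine ⟨_, pushWeight I f, fun p _ => ⟨Nat.cast_nonneg _, pushWeight_mono hI f p⟩, ?_, rfl⟩
    rw [sum_pushWeight P I hI, hcard, Nat.cast_sub hm]
  · rintro y ⟨w', hw', hsum, rfl⟩
    have h₁ : ∑ s ∈ P.image f, w' s * τ ≤ ∑ s ∈ P.image f,
        (w' s * |s - c| + pushWeight P f s * max (τ - |s - c|) 0) := by
      refine Finset.sum_le_sum fun s hs => ?_
      have h₂ := mul_le_mul_of_nonneg_left (le_max_left (τ - |s - c|) 0) (hw' s hs).1
      have h₃ := mul_le_mul_of_nonneg_right (hw' s hs).2 (le_max_right (τ - |s - c|) 0)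
      linarith
    rw [← Finset.sum_mul, hsum, Finset.sum_add_distrib,
      sum_pushWeight_mul P P (Finset.Subset.refl P) f fun s => max (τ - |s - c|) 0] at h₁
    linarith

theorem abs_wrcost_sub_rcost_le {m : ℕ} {P : Finset ℝ} (hm : m < P.card) {f : ℝ → ℝ} {c η : ℝ}
    (h : ∀ τ, (IsLevel P (fun p => |p - c|) (P.card - m) τ ∨
        IsLevel P (fun p => |f p - c|) (P.card - m) τ) →
      |∑ p ∈ P, (max (τ - |p - c|) 0 - max (τ - |f p - c|) 0)| ≤ η) :
    |wrcost ((P.card : ℝ) - m) (P.image f) (pushWeight P f) c - rcost m P c| ≤ η := by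
  obtain ⟨τ, hτ⟩ := exists_isLevel (P := P) (fun p => |p - c|) (k := P.card - m)
    (by omega) (Nat.sub_le _ _)
  obtain ⟨τ', hτ'⟩ := exists_isLevel (P := P) (fun p => |f p - c|) (k := P.card - m)
    (by omega) (Nat.sub_le _ _)
  have h₁ := h τ (Or.inl hτ)
  have h₂ := h τ' (Or.inr hτ')
  rw [Finset.sum_sub_distrib, abs_le] at h₁ h₂
  have := hτ.rcost_le hm.le
  have := hτ'.wrcost_le hm.le
  have := dual_le_rcost hm.le c τ'
  have := dual_le_wrcost hm.le f c τ
  rw [abs_le]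
  constructor <;> linarith

theorem exists_card_filter_lt {P : Finset ℝ} {k : ℕ} (hk : k < P.card) :
    ∃ a ∈ P, (P.filter fun p => a < p).card = k := by
  induction k with
  | zero =>
    refine ⟨P.max' (Finset.card_pos.mp hk), Finset.max'_mem _ _, ?_⟩
    rw [Finset.card_eq_zero, Finset.filter_eq_empty_iff]
    exact fun p hp => not_lt.mpr (Finset.le_max' _ _ hp)
  | succ k ih =>
    obtain ⟨a, ha, hcard⟩ := ih (by omega)
    have hne : (P.filter fun p => p < a).Nonempty := by
      rw [← Finset.card_pos]
      have hsplit := Finset.card_filter_add_card_filter_not (s := P) (fun p => a < p)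
      have hins : (P.filter fun p => ¬ a < p) = insert a (P.filter fun p => p < a) := by
        ext p
        simp only [Finset.mem_filter, Finset.mem_insert, not_lt, le_iff_eq_or_lt]
        constructor
        · tauto
        · rintro (rfl | h) <;> tauto
      rw [hins, Finset.card_insert_of_notMem (by simp)] at hsplit
      omega
    obtain ⟨b, hb, hmax⟩ := Finset.exists_max_image _ id hne
    rw [Finset.mem_filter] at hb
    refine ⟨b, hb.1, ?_⟩
    have : (P.filter fun p => b < p) = insert a (P.filter fun p => a < p) := by
      ext p
      simp only [Finset.mem_filter, Finset.mem_insert]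
      constructor
      · rintro ⟨hp, hbp⟩
        rcases lt_trichotomy p a with h | h | h
        · have := hmax p (Finset.mem_filter.mpr ⟨hp, h⟩)
          simp only [id] at this
          linarith
        · exact Or.inl h
        · exact Or.inr ⟨hp, h⟩
      · rintro (rfl | h)
        · exact ⟨ha, hb.2⟩
        · exact ⟨h.1, hb.2.trans h.2⟩
    rw [this, Finset.card_insert_of_notMem (by simp), hcard]

theorem rcost_le_add {m : ℕ} {P : Finset ℝ} (hm : m ≤ P.card) (c c' : ℝ) :
    rcost m P c' ≤ rcost m P c + P.card * |c - c'| := by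
  rw [← sub_le_iff_le_add]
  refine le_rcost hm fun I hI hcard => ?_
  have h₁ : ∑ p ∈ I, |p - c'| ≤ ∑ p ∈ I, (|p - c| + |c - c'|) :=
    Finset.sum_le_sum fun p _ => abs_sub_le _ _ _
  rw [Finset.sum_add_distrib, Finset.sum_const, nsmul_eq_mul] at h₁
  have h₂ : (I.card : ℝ) * |c - c'| ≤ P.card * |c - c'| :=
    mul_le_mul_of_nonneg_right (Nat.cast_le.mpr (Finset.card_le_card hI)) (abs_nonneg _)
  linarith [rcost_le (c := c') hI hcard]

/-- If `j` points are at distance at least `R` from `c`, then at least `j - m` of them are kept. -/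
theorem mul_le_rcost {m : ℕ} {P Q : Finset ℝ} (hm : m ≤ P.card) (hQ : Q ⊆ P) {c R x : ℝ}
    (hR : 0 ≤ R) (hdist : ∀ p ∈ Q, R ≤ |p - c|) (hx : x + m ≤ Q.card) :
    x * R ≤ rcost m P c := by
  refine le_rcost hm fun I hI hcard => ?_
  have h₁ : ∑ p ∈ I ∩ Q, R ≤ ∑ p ∈ I ∩ Q, |p - c| :=
    Finset.sum_le_sum fun p hp => hdist p (Finset.mem_inter.mp hp).2
  have h₂ : ∑ p ∈ I ∩ Q, |p - c| ≤ ∑ p ∈ I, |p - c| :=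
    Finset.sum_le_sum_of_subset_of_nonneg Finset.inter_subset_left fun _ _ _ => abs_nonneg _
  rw [Finset.sum_const, nsmul_eq_mul] at h₁
  have h₃ : Q.card ≤ (I ∩ Q).card + m := by
    have := Finset.card_union_add_card_inter I Q
    have := Finset.card_le_card (Finset.union_subset hI hQ)
    omega
  have h₄ : (Q.card : ℝ) ≤ (I ∩ Q).card + m := by exact_mod_cast h₃
  have h₅ : x * R ≤ (I ∩ Q).card * R := mul_le_mul_of_nonneg_right (by linarith) hR
  linarith

theorem card_mul_abs_le_rcost {m : ℕ} {P : Finset ℝ} (hm : 4 * m ≤ P.card) {c₀ : ℝ}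
    (hc₀ : c₀ ∈ P) (hmed : (P.filter fun p => c₀ < p).card = P.card / 2) (c : ℝ) :
    P.card * |c - c₀| ≤ 4 * rcost m P c := by
  have hm' : (4 * m : ℝ) ≤ P.card := by exact_mod_cast hm
  suffices h : (P.card / 4 : ℝ) * |c - c₀| ≤ rcost m P c by linarith
  rcases le_total c₀ c with h | h
  · refine mul_le_rcost (by omega) (Finset.filter_subset (fun p => ¬ c₀ < p) P) (abs_nonneg _)
      (fun p hp => ?_) ?_
    · rw [Finset.mem_filter, not_lt] at hp
      rw [abs_of_nonneg (by linarith), abs_of_nonpos (by linarith)]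
      linarith
    · have hsplit := Finset.card_filter_add_card_filter_not (s := P) (fun p => c₀ < p)
      have h₁ : P.card ≤ 2 * (P.filter fun p => ¬ c₀ < p).card := by omega
      have h₂ : (P.card : ℝ) ≤ 2 * (P.filter fun p => ¬ c₀ < p).card := by exact_mod_cast h₁
      linarith
  · refine mul_le_rcost (by omega) (Q := insert c₀ (P.filter fun p => c₀ < p))
      (Finset.insert_subset hc₀ (Finset.filter_subset _ P)) (abs_nonneg _) (fun p hp => ?_) ?_
    · have hp' : c₀ ≤ p := by
        rcases Finset.mem_insert.mp hp with rfl | hp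
        · exact le_rfl
        · exact (Finset.mem_filter.mp hp).2.le
      rw [abs_of_nonpos (by linarith), abs_of_nonneg (by linarith)]
      linarith
    · rw [Finset.card_insert_of_notMem (by simp), hmed]
      have h₁ : P.card ≤ 2 * (P.card / 2 + 1) := by omega
      have h₂ : (P.card : ℝ) ≤ 2 * ((P.card / 2 + 1 : ℕ) : ℝ) := by exact_mod_cast h₁
      linarith

/-- The mean of a finite set of reals. -/
noncomputable def mean (B : Finset ℝ) : ℝ := (∑ p ∈ B, p) / B.card

theorem card_mul_mean {B : Finset ℝ} (hB : B.Nonempty) : B.card * mean B = ∑ p ∈ B, p := by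
  have : (B.card : ℝ) ≠ 0 := Nat.cast_ne_zero.mpr (Finset.card_ne_zero.mpr hB)
  rw [mean]
  field_simp

theorem mean_mem_Icc {B : Finset ℝ} (hB : B.Nonempty) {l r : ℝ} (h : ∀ p ∈ B, p ∈ Set.Icc l r) :
    mean B ∈ Set.Icc l r := by
  have hpos : (0 : ℝ) < B.card := Nat.cast_pos.mpr (Finset.card_pos.mpr hB)
  have h₁ := Finset.card_nsmul_le_sum B (fun p => p) l fun p hp => (h p hp).1
  have h₂ := Finset.sum_le_card_nsmul B (fun p => p) r fun p hp => (h p hp).2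
  rw [nsmul_eq_mul] at h₁ h₂
  rw [mean]
  exact ⟨by rw [le_div_iff₀ hpos]; linarith, by rw [div_le_iff₀ hpos]; linarith⟩

theorem sum_sub_mean_eq_zero_of_affine {B : Finset ℝ} (hB : B.Nonempty) {l r : ℝ}
    (h : ∀ p ∈ B, p ∈ Set.Icc l r) {g : ℝ → ℝ} {a b : ℝ}
    (hg : ∀ q ∈ Set.Icc l r, g q = a * q + b) : ∑ p ∈ B, (g p - g (mean B)) = 0 := by
  rw [hg _ (mean_mem_Icc hB h), Finset.sum_congr rfl fun p hp => by rw [hg p (h p hp)],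
    Finset.sum_sub_distrib, Finset.sum_add_distrib, ← Finset.mul_sum, ← card_mul_mean hB]
  simp
  ring

/-- The truncated distance `(τ - |q - c|)₊`. -/
noncomputable def tent (c τ q : ℝ) : ℝ := max (τ - |q - c|) 0

theorem abs_tent_sub_le (c τ p q : ℝ) : |tent c τ p - tent c τ q| ≤ |p - q| := by
  refine (abs_max_sub_max_le_abs _ _ _).trans ?_
  rw [show τ - |p - c| - (τ - |q - c|) = |q - c| - |p - c| by ring, abs_sub_comm p q]
  exact (abs_abs_sub_abs_le _ _).trans (by rw [show q - c - (p - c) = q - p by ring])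

theorem tent_affine {c τ l r : ℝ} (h₁ : c - τ ∉ Set.Icc l r) (h₂ : c ∉ Set.Icc l r)
    (h₃ : c + τ ∉ Set.Icc l r) : ∃ a b, ∀ q ∈ Set.Icc l r, tent c τ q = a * q + b := by
  simp only [Set.mem_Icc, not_and_or, not_le] at h₁ h₂ h₃
  by_cases hlr : r < l
  · exact ⟨0, 0, fun q hq => absurd (hq.1.trans hq.2) (not_le.mpr hlr)⟩
  by_cases hτ : τ < 0
  · refine ⟨0, 0, fun q hq => ?_⟩
    rw [tent, max_eq_right (by linarith [abs_nonneg (q - c)])]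
    ring
  by_cases h₄ : r < c
  · by_cases h₅ : r < c - τ
    · refine ⟨0, 0, fun q hq => ?_⟩
      rw [tent, abs_of_nonpos (by linarith [hq.2]), max_eq_right (by linarith [hq.2])]
      ring
    · refine ⟨1, τ - c, fun q hq => ?_⟩
      have : c - τ < l := by tauto
      rw [tent, abs_of_nonpos (by linarith [hq.2]), max_eq_left (by linarith [hq.1])]
      ring
  · have h₆ : c < l := by tauto
    by_cases h₅ : r < c + τ
    · refine ⟨-1, τ + c, fun q hq => ?_⟩
      rw [tent, abs_of_nonneg (by linarith [hq.1]), max_eq_left (by linarith [hq.2])]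
      ring
    · refine ⟨0, 0, fun q hq => ?_⟩
      have : c + τ < l := by tauto
      rw [tent, abs_of_nonneg (by linarith [hq.1]), max_eq_right (by linarith [hq.1])]
      ring

theorem abs_sum_sub_mean_le {B : Finset ℝ} {g : ℝ → ℝ} {M : ℝ}
    (h : ∀ p ∈ B, |g p - g (mean B)| ≤ M) :
    |∑ p ∈ B, (g p - g (mean B))| ≤ B.card * M := by
  refine (Finset.abs_sum_le_sum_abs _ _).trans ((Finset.sum_le_sum h).trans ?_)
  rw [Finset.sum_const, nsmul_eq_mul]

theorem abs_sum_tent_le_card_mul {B : Finset ℝ} (hB : B.Nonempty) {l r : ℝ}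
    (h : ∀ p ∈ B, p ∈ Set.Icc l r) (c τ : ℝ) :
    |∑ p ∈ B, (tent c τ p - tent c τ (mean B))| ≤ B.card * (r - l) := by
  refine abs_sum_sub_mean_le fun p hp => (abs_tent_sub_le _ _ _ _).trans ?_
  have h₁ := h p hp
  have h₂ := mean_mem_Icc hB h
  rw [abs_le]
  constructor <;> linarith [h₁.1, h₁.2, h₂.1, h₂.2]

theorem abs_sum_tent_le_sum_abs {B : Finset ℝ} (hB : B.Nonempty) (c τ c₀ : ℝ) :
    |∑ p ∈ B, (tent c τ p - tent c τ (mean B))| ≤ 2 * ∑ p ∈ B, |p - c₀| := by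
  have hmean : B.card * |mean B - c₀| ≤ ∑ p ∈ B, |p - c₀| := by
    rw [← abs_of_nonneg (Nat.cast_nonneg (α := ℝ) B.card), ← abs_mul, mul_sub, card_mul_mean hB,
      ← nsmul_eq_mul, ← Finset.sum_const, ← Finset.sum_sub_distrib]
    exact Finset.abs_sum_le_sum_abs _ _
  calc |∑ p ∈ B, (tent c τ p - tent c τ (mean B))|
      ≤ ∑ p ∈ B, |tent c τ p - tent c τ (mean B)| := Finset.abs_sum_le_sum_abs _ _
    _ ≤ ∑ p ∈ B, (|p - c₀| + |mean B - c₀|) := Finset.sum_le_sum fun p _ =>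
        (abs_tent_sub_le _ _ _ _).trans
          ((abs_sub_le p c₀ (mean B)).trans (by rw [abs_sub_comm c₀ (mean B)]))
    _ ≤ 2 * ∑ p ∈ B, |p - c₀| := by
        rw [Finset.sum_add_distrib, Finset.sum_const, nsmul_eq_mul]
        linarith

/-- Outside the ball of radius `τ₀` around `c₀` the tent function is small. -/
theorem tent_le_of_far {c τ c₀ τ₀ q : ℝ} (hτ : τ ≤ τ₀ + |c - c₀|) (hq : τ₀ ≤ |q - c₀|) :
    tent c τ q ≤ 2 * |c - c₀| := by
  refine max_le ?_ (by positivity)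
  linarith [abs_sub_le q c c₀]

theorem abs_tent_sub_le_of_far {c τ c₀ τ₀ p q : ℝ} (hτ : τ ≤ τ₀ + |c - c₀|)
    (hp : τ₀ ≤ |p - c₀|) (hq : τ₀ ≤ |q - c₀|) :
    |tent c τ p - tent c τ q| ≤ 2 * |c - c₀| := by
  have h₁ := tent_le_of_far hτ hp
  have h₂ := tent_le_of_far hτ hq
  have h₃ : 0 ≤ tent c τ p := le_max_right _ _
  have h₄ : 0 ≤ tent c τ q := le_max_right _ _
  rw [abs_le]
  constructor <;> linarith

/-- Indicators of `a ≤ q` and `a < q`, added: a step at `a` isolating the point `a`. -/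
noncomputable def cut (a q : ℝ) : ℝ := (if a ≤ q then 1 else 0) + if a < q then 1 else 0

theorem cut_mono (a : ℝ) {p q : ℝ} (h : p ≤ q) : cut a p ≤ cut a q := by
  unfold cut
  split_ifs <;> linarith

theorem cut_nonneg (a q : ℝ) : 0 ≤ cut a q := by
  unfold cut
  split_ifs <;> norm_num

theorem cut_le_two (a q : ℝ) : cut a q ≤ 2 := by
  unfold cut
  split_ifs <;> norm_num

theorem same_side_of_cut {a p q : ℝ} (hpq : p < q) (h : cut a q - cut a p < 1) :
    q < a ∨ a < p := by
  by_contra! hcon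
  unfold cut at h
  rcases hcon.2.lt_or_eq with h₁ | h₁
  · rw [if_pos hcon.1, if_neg (not_le.mpr h₁), if_neg (not_lt.mpr h₁.le)] at h
    split_ifs at h <;> linarith
  · subst h₁
    rw [if_pos hcon.1, if_pos hpq, if_pos le_rfl, if_neg (lt_irrefl _)] at h
    linarith

/-- The logarithmic size of a distance `v`, in units of `U`, truncated at `U / δ`. -/
noncomputable def logSize (U δ v : ℝ) : ℝ := Real.log (1 + min (v / U) (1 / δ))

theorem logSize_mono {U δ v v' : ℝ} (hU : 0 < U) (hδ : 0 < δ) (hv : 0 ≤ v) (h : v ≤ v') :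
    logSize U δ v ≤ logSize U δ v' := by
  unfold logSize
  have h₁ : 0 ≤ min (v / U) (1 / δ) := by positivity
  refine Real.log_le_log (by linarith) ?_
  have := div_le_div_of_nonneg_right h hU.le
  gcongr

theorem logSize_nonneg {U δ v : ℝ} (hU : 0 < U) (hδ : 0 < δ) (hv : 0 ≤ v) : 0 ≤ logSize U δ v := by
  have h₁ : 0 ≤ min (v / U) (1 / δ) := by positivity
  exact Real.log_nonneg (by linarith)

theorem logSize_le {U δ v : ℝ} (hU : 0 < U) (hδ : 0 < δ) (hv : 0 ≤ v) :
    logSize U δ v ≤ Real.log (1 + 1 / δ) := by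
  have h₁ : 0 ≤ min (v / U) (1 / δ) := by positivity
  exact Real.log_le_log (by linarith) (by linarith [min_le_right (v / U) (1 / δ)])

theorem sub_le_or_le_of_logSize {U s v v' : ℝ} (hU : 0 < U) (hs : 0 < s) (hs' : s ≤ 1 / 10)
    (hv : 0 ≤ v) (hvv' : v ≤ v') (h : logSize U (s ^ 2) v' - logSize U (s ^ 2) v < s) :
    v' - v ≤ 2 * s * (U + v) ∨ U ≤ 2 * s ^ 2 * v := by
  unfold logSize at h
  have hv' : 0 ≤ v' := hv.trans hvv'
  have hu : 0 ≤ min (v / U) (1 / s ^ 2) := by positivity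
  have hu' : 0 ≤ min (v' / U) (1 / s ^ 2) := by positivity
  have hexp : Real.exp s ≤ 1 + 2 * s := by
    have h₁ := Real.abs_exp_sub_one_sub_id_le (x := s) (by rw [abs_of_pos hs]; linarith)
    have h₂ := (abs_le.mp h₁).2
    nlinarith
  have hkey : 1 + min (v' / U) (1 / s ^ 2) ≤ (1 + 2 * s) * (1 + min (v / U) (1 / s ^ 2)) := by
    rw [← Real.log_div (by linarith) (by linarith)] at h
    have h₁ := (Real.log_lt_iff_lt_exp (by positivity)).mp h
    rw [div_lt_iff₀ (by linarith)] at h₁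
    nlinarith
  rcases le_total (v' / U) (1 / s ^ 2) with h₁ | h₁
  · left
    have h₂ : v / U ≤ v' / U := div_le_div_of_nonneg_right hvv' hU.le
    rw [min_eq_left h₁, min_eq_left (h₂.trans h₁)] at hkey
    have h₃ := mul_le_mul_of_nonneg_right hkey hU.le
    have h₄ : v / U * U = v := div_mul_cancel₀ _ hU.ne'
    have h₅ : v' / U * U = v' := div_mul_cancel₀ _ hU.ne'
    nlinarith
  · right
    rw [min_eq_right h₁] at hkey
    have h₂ := min_le_left (v / U) (1 / s ^ 2)
    have h₃ : 1 + 1 / s ^ 2 ≤ (1 + 2 * s) * (1 + v / U) :=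
      hkey.trans (mul_le_mul_of_nonneg_left (by linarith) (by linarith))
    have h₄ : 100 ≤ 1 / s ^ 2 := by
      rw [le_div_iff₀ (by positivity)]
      nlinarith
    have h₅ : 1 / s ^ 2 ≤ 2 * (v / U) := by
      have : 0 ≤ v / U := by positivity
      nlinarith
    rw [div_le_iff₀ (by positivity)] at h₅
    have h₆ : v / U * U = v := div_mul_cancel₀ _ hU.ne'
    nlinarith [mul_le_mul_of_nonneg_right h₅ hU.le]

/-- The signed logarithmic position of `q` relative to `α`. -/
noncomputable def logPos (U δ α q : ℝ) : ℝ :=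
  logSize U δ (max (q - α) 0) - logSize U δ (max (α - q) 0)

theorem logPos_mono {U δ : ℝ} (hU : 0 < U) (hδ : 0 < δ) (α : ℝ) {p q : ℝ} (h : p ≤ q) :
    logPos U δ α p ≤ logPos U δ α q :=
  sub_le_sub (logSize_mono hU hδ (le_max_right _ _) (max_le_max (by linarith) le_rfl))
    (logSize_mono hU hδ (le_max_right _ _) (max_le_max (by linarith) le_rfl))

theorem abs_logPos_le {U δ : ℝ} (hU : 0 < U) (hδ : 0 < δ) (α q : ℝ) :
    |logPos U δ α q| ≤ Real.log (1 + 1 / δ) := by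
  have h₁ := logSize_nonneg hU hδ (le_max_right (q - α) 0)
  have h₂ := logSize_nonneg hU hδ (le_max_right (α - q) 0)
  have h₃ := logSize_le hU hδ (le_max_right (q - α) 0)
  have h₄ := logSize_le hU hδ (le_max_right (α - q) 0)
  rw [logPos, abs_le]
  constructor <;> linarith

theorem sub_le_or_le_of_logPos {U s α p q : ℝ} (hU : 0 < U) (hs : 0 < s) (hs' : s ≤ 1 / 10)
    (hpq : p < q) (hside : q < α ∨ α < p) (h : logPos U (s ^ 2) α q - logPos U (s ^ 2) α p < s) :
    (∀ z ∈ Set.Icc p q, q - p ≤ 2 * s * (U + |z - α|)) ∨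
      (∀ z ∈ Set.Icc p q, U ≤ 2 * s ^ 2 * |z - α|) := by
  have hzero : logSize U (s ^ 2) 0 = 0 := by
    have : (0 : ℝ) ≤ 1 / s ^ 2 := by positivity
    rw [logSize, zero_div, min_eq_left this, add_zero, Real.log_one]
  unfold logPos at h
  rcases hside with hα | hα
  · rw [max_eq_right (by linarith), max_eq_left (by linarith), max_eq_right (by linarith),
      max_eq_left (by linarith), hzero] at h
    rcases sub_le_or_le_of_logSize hU hs hs' (v := α - q) (v' := α - p) (by linarith)
      (by linarith) (by linarith) with h₁ | h₁
    · left
      intro z hz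
      rw [abs_of_nonpos (by linarith [hz.2])]
      nlinarith [hz.2]
    · right
      intro z hz
      rw [abs_of_nonpos (by linarith [hz.2])]
      nlinarith [hz.2, sq_nonneg s]
  · rw [max_eq_left (by linarith), max_eq_right (by linarith), max_eq_left (by linarith),
      max_eq_right (by linarith), hzero] at h
    rcases sub_le_or_le_of_logSize hU hs hs' (v := p - α) (v' := q - α) (by linarith)
      (by linarith) (by linarith) with h₁ | h₁
    · left
      intro z hz
      rw [abs_of_nonneg (by linarith [hz.1])]
      nlinarith [hz.1]
    · right
      intro z hz
      rw [abs_of_nonneg (by linarith [hz.1])]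
      nlinarith [hz.1, sq_nonneg s]

/-- The mass that each point contributes to the potential: points beyond `aL` or `aR` are heavy. -/
noncomputable def mass (P : Finset ℝ) (aL aR s p : ℝ) : ℝ :=
  (if aR < p then 1 / (s ^ 2 * P.card) else 0) + (if p < aL then 1 / (s ^ 2 * P.card) else 0) +
    1 / (s * P.card)

theorem mass_nonneg (P : Finset ℝ) (aL aR : ℝ) {s : ℝ} (hs : 0 < s) (p : ℝ) :
    0 ≤ mass P aL aR s p := by
  have h₁ : 0 ≤ 1 / (s ^ 2 * (P.card : ℝ)) := by positivity
  have h₂ : 0 ≤ 1 / (s * (P.card : ℝ)) := by positivity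
  unfold mass
  split_ifs <;> linarith

theorem sum_mass_le {P : Finset ℝ} {m : ℕ} {aL aR s : ℝ} (hs : 0 < s) (hP : P.Nonempty)
    (hL : (P.filter fun p => p < aL).card = m) (hR : (P.filter fun p => aR < p).card = m) :
    ∑ p ∈ P, mass P aL aR s p ≤ 2 * (m / P.card) / s ^ 2 + 1 / s := by
  have hn : (0 : ℝ) < P.card := Nat.cast_pos.mpr (Finset.card_pos.mpr hP)
  unfold mass
  rw [Finset.sum_add_distrib, Finset.sum_add_distrib, ← Finset.sum_filter, ← Finset.sum_filter]
  simp only [Finset.sum_const, hL, hR, nsmul_eq_mul]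
  apply le_of_eq
  field_simp
  ring

/-- A monotone potential; points whose potentials have the same integer part share a bucket. -/
noncomputable def potential (P : Finset ℝ) (c₀ τ₀ aL aR U s q : ℝ) : ℝ :=
  (cut c₀ q + cut (c₀ - τ₀) q + cut (c₀ + τ₀) q + cut aL q + cut aR q) +
    (logPos U (s ^ 2) c₀ q + logPos U (s ^ 2) (c₀ - τ₀) q + logPos U (s ^ 2) (c₀ + τ₀) q +
      3 * Real.log (1 + 1 / s ^ 2)) / s +
    ∑ p ∈ P.filter (fun p => p ≤ q), mass P aL aR s p

theorem potential_sub {P : Finset ℝ} {c₀ τ₀ aL aR U s p q : ℝ} (hpq : p ≤ q) :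
    potential P c₀ τ₀ aL aR U s q - potential P c₀ τ₀ aL aR U s p =
      (cut c₀ q - cut c₀ p) + (cut (c₀ - τ₀) q - cut (c₀ - τ₀) p) +
      (cut (c₀ + τ₀) q - cut (c₀ + τ₀) p) + (cut aL q - cut aL p) + (cut aR q - cut aR p) +
      (logPos U (s ^ 2) c₀ q - logPos U (s ^ 2) c₀ p) / s +
      (logPos U (s ^ 2) (c₀ - τ₀) q - logPos U (s ^ 2) (c₀ - τ₀) p) / s +
      (logPos U (s ^ 2) (c₀ + τ₀) q - logPos U (s ^ 2) (c₀ + τ₀) p) / s +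
      ∑ x ∈ P.filter (fun x => p < x ∧ x ≤ q), mass P aL aR s x := by
  have hsplit : ∑ x ∈ P.filter (fun x => x ≤ q), mass P aL aR s x =
      ∑ x ∈ P.filter (fun x => x ≤ p), mass P aL aR s x +
        ∑ x ∈ P.filter (fun x => p < x ∧ x ≤ q), mass P aL aR s x := by
    rw [← Finset.sum_union]
    · congr 1
      ext x
      simp only [Finset.mem_filter, Finset.mem_union]
      constructor
      · rintro ⟨hx, hxq⟩
        rcases le_or_gt x p with h | h
        · exact Or.inl ⟨hx, h⟩
        · exact Or.inr ⟨hx, h, hxq⟩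
      · rintro (⟨hx, h⟩ | ⟨hx, -, h⟩)
        · exact ⟨hx, h.trans hpq⟩
        · exact ⟨hx, h⟩
    · rw [Finset.disjoint_filter]
      exact fun x _ h₁ h₂ => absurd h₂.1 (not_lt.mpr h₁)
  unfold potential
  rw [hsplit]
  ring

theorem potential_mono {P : Finset ℝ} {c₀ τ₀ aL aR U s : ℝ} (hU : 0 < U) (hs : 0 < s) :
    Monotone (potential P c₀ τ₀ aL aR U s) := by
  intro p q hpq
  rw [← sub_nonneg, potential_sub hpq]
  have hcut := fun a => sub_nonneg.mpr (cut_mono a hpq)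
  have hlog := fun α => div_nonneg
    (sub_nonneg.mpr (logPos_mono hU (sq_pos_of_pos hs) α hpq)) hs.le
  have hmass := Finset.sum_nonneg fun x (_ : x ∈ P.filter (fun x => p < x ∧ x ≤ q)) =>
    mass_nonneg P aL aR hs x
  linarith [hcut c₀, hcut (c₀ - τ₀), hcut (c₀ + τ₀), hcut aL, hcut aR, hlog c₀, hlog (c₀ - τ₀),
    hlog (c₀ + τ₀)]

theorem potential_nonneg {P : Finset ℝ} {c₀ τ₀ aL aR U s : ℝ} (hU : 0 < U) (hs : 0 < s) (q : ℝ) :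
    0 ≤ potential P c₀ τ₀ aL aR U s q := by
  have hlog := fun α => (abs_le.mp (abs_logPos_le hU (sq_pos_of_pos hs) α q)).1
  have h₁ : 0 ≤ (logPos U (s ^ 2) c₀ q + logPos U (s ^ 2) (c₀ - τ₀) q +
      logPos U (s ^ 2) (c₀ + τ₀) q + 3 * Real.log (1 + 1 / s ^ 2)) / s :=
    div_nonneg (by linarith [hlog c₀, hlog (c₀ - τ₀), hlog (c₀ + τ₀)]) hs.le
  have h₂ := Finset.sum_nonneg fun x (_ : x ∈ P.filter (fun x => x ≤ q)) =>
    mass_nonneg P aL aR hs x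
  unfold potential
  linarith [cut_nonneg c₀ q, cut_nonneg (c₀ - τ₀) q, cut_nonneg (c₀ + τ₀) q, cut_nonneg aL q,
    cut_nonneg aR q]

theorem potential_le {P : Finset ℝ} {m : ℕ} {c₀ τ₀ aL aR U s : ℝ} (hU : 0 < U) (hs : 0 < s)
    (hP : P.Nonempty) (hL : (P.filter fun p => p < aL).card = m)
    (hR : (P.filter fun p => aR < p).card = m) (q : ℝ) :
    potential P c₀ τ₀ aL aR U s q ≤
      10 + 6 * Real.log (1 + 1 / s ^ 2) / s + 2 * (m / P.card) / s ^ 2 + 1 / s := by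
  have hlog := fun α => (abs_le.mp (abs_logPos_le hU (sq_pos_of_pos hs) α q)).2
  have h₁ : (logPos U (s ^ 2) c₀ q + logPos U (s ^ 2) (c₀ - τ₀) q +
      logPos U (s ^ 2) (c₀ + τ₀) q + 3 * Real.log (1 + 1 / s ^ 2)) / s ≤
      6 * Real.log (1 + 1 / s ^ 2) / s :=
    div_le_div_of_nonneg_right (by linarith [hlog c₀, hlog (c₀ - τ₀), hlog (c₀ + τ₀)]) hs.le
  have h₂ : ∑ x ∈ P.filter (fun x => x ≤ q), mass P aL aR s x ≤ ∑ x ∈ P, mass P aL aR s x :=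
    Finset.sum_le_sum_of_subset_of_nonneg (Finset.filter_subset _ _) fun x _ _ =>
      mass_nonneg P aL aR hs x
  have h₃ := sum_mass_le hs hP hL hR
  unfold potential
  linarith [cut_le_two c₀ q, cut_le_two (c₀ - τ₀) q, cut_le_two (c₀ + τ₀) q, cut_le_two aL q,
    cut_le_two aR q]

theorem close_of_potential {P : Finset ℝ} {c₀ τ₀ aL aR U s l r : ℝ} (hU : 0 < U) (hs : 0 < s)
    (hlr : l ≤ r)
    (h : potential P c₀ τ₀ aL aR U s r - potential P c₀ τ₀ aL aR U s l < 1) :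
    (∀ a ∈ ({c₀, c₀ - τ₀, c₀ + τ₀, aL, aR} : Set ℝ), cut a r - cut a l < 1) ∧
    (∀ α ∈ ({c₀, c₀ - τ₀, c₀ + τ₀} : Set ℝ), logPos U (s ^ 2) α r - logPos U (s ^ 2) α l < s) ∧
    ∑ x ∈ P.filter (fun x => l < x ∧ x ≤ r), mass P aL aR s x < 1 := by
  rw [potential_sub hlr] at h
  have hcut := fun a => sub_nonneg.mpr (cut_mono a hlr)
  have hlog := fun α => div_nonneg
    (sub_nonneg.mpr (logPos_mono hU (sq_pos_of_pos hs) α hlr)) hs.le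
  have hmass := Finset.sum_nonneg fun x (_ : x ∈ P.filter (fun x => l < x ∧ x ≤ r)) =>
    mass_nonneg P aL aR hs x
  have h₁ := hcut c₀
  have h₂ := hcut (c₀ - τ₀)
  have h₃ := hcut (c₀ + τ₀)
  have h₄ := hcut aL
  have h₅ := hcut aR
  have h₆ := hlog c₀
  have h₇ := hlog (c₀ - τ₀)
  have h₈ := hlog (c₀ + τ₀)
  refine ⟨?_, ?_, by linarith⟩
  · rintro a (rfl | rfl | rfl | rfl | rfl) <;> linarith
  · intro α hα
    have : (logPos U (s ^ 2) α r - logPos U (s ^ 2) α l) / s < 1 := by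
      rcases hα with (rfl | rfl | rfl) <;> linarith
    rwa [div_lt_one hs] at this

theorem card_lt_of_sum_mass {P Q : Finset ℝ} {aL aR s y : ℝ} (hy : 0 < y)
    (h : ∑ x ∈ Q, mass P aL aR s x < 1) (hQ : ∀ x ∈ Q, 1 / y ≤ mass P aL aR s x) :
    (Q.card : ℝ) < y := by
  have h₁ := Finset.card_nsmul_le_sum Q _ _ hQ
  rw [nsmul_eq_mul, mul_one_div] at h₁
  exact (div_lt_one hy).mp (h₁.trans_lt h)

set_option maxHeartbeats 1000000 in
theorem abs_sum_tent_sub_mean_le {P B : Finset ℝ} {c₀ τ₀ aL aR U s l r c τ : ℝ} (hU : 0 < U)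
    (hs : 0 < s) (hs' : s ≤ 1 / 10) (hl : l ∈ B) (hr : r ∈ B) (hlr : l < r) (hBP : B ⊆ P)
    (hB : ∀ p ∈ B, p ∈ Set.Icc l r)
    (hpot : potential P c₀ τ₀ aL aR U s r - potential P c₀ τ₀ aL aR U s l < 1)
    (hinside : ∑ p ∈ P.filter (fun p => |p - c₀| < τ₀), |p - c₀| ≤ P.card * U)
    (hτ : |τ - τ₀| ≤ |c - c₀|)
    (hR : aR ≤ c₀ + τ₀) (hL : c₀ - τ₀ ≤ aL)
    (hzR : c + τ ∈ Set.Icc l r → aR ≤ r) (hzL : c - τ ∈ Set.Icc l r → l ≤ aL)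
    (hz : c ∈ Set.Icc l r ∨ c - τ ∈ Set.Icc l r ∨ c + τ ∈ Set.Icc l r) :
    |∑ p ∈ B, (tent c τ p - tent c τ (mean B))| ≤
      12 * s ^ 2 * (P.card * U + P.card * |c - c₀|) := by
  obtain ⟨hcut, hlog, hmass⟩ := close_of_potential hU hs hlr.le hpot
  have hside := fun a ha => same_side_of_cut hlr (hcut a ha)
  have hBne : B.Nonempty := ⟨l, hl⟩
  have hn : (0 : ℝ) < P.card := Nat.cast_pos.mpr (Finset.card_pos.mpr ⟨l, hBP hl⟩)
  have hR0 : 0 ≤ |c - c₀| := abs_nonneg _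
  have hnR : 0 ≤ P.card * |c - c₀| := by positivity
  have hnU : 0 ≤ P.card * U := by positivity
  have hs2 : 0 < s ^ 2 := by positivity
  set Q := P.filter (fun x => l < x ∧ x ≤ r) with hQ
  have hcard : (B.card : ℝ) ≤ 2 * Q.card := by
    have hsub : B ⊆ insert l Q := by
      intro p hp
      rcases (hB p hp).1.eq_or_lt with h | h
      · exact h ▸ Finset.mem_insert_self _ _
      · exact Finset.mem_insert_of_mem (Finset.mem_filter.mpr ⟨hBP hp, h, (hB p hp).2⟩)
    have h₁ := (Finset.card_le_card hsub).trans (Finset.card_insert_le _ _)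
    have h₂ : 0 < Q.card := Finset.card_pos.mpr ⟨r, Finset.mem_filter.mpr ⟨hBP hr, hlr, le_rfl⟩⟩
    exact_mod_cast (by omega : B.card ≤ 2 * Q.card)
  have hheavy : 0 ≤ 1 / (s ^ 2 * (P.card : ℝ)) := by positivity
  have hlight : 0 ≤ 1 / (s * (P.card : ℝ)) := by positivity
  have hcard₁ : (Q.card : ℝ) < s * P.card := by
    refine card_lt_of_sum_mass (by positivity) hmass fun x _ => ?_
    unfold mass
    split_ifs <;> linarith
  have hcardR : aR ≤ r → (Q.card : ℝ) < s ^ 2 * P.card := by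
    intro har
    have hal : aR < l := (hside aR (by simp)).resolve_left (by linarith)
    refine card_lt_of_sum_mass (by positivity) hmass fun x hx => ?_
    unfold mass
    rw [if_pos (hal.trans (Finset.mem_filter.mp hx).2.1)]
    split_ifs <;> linarith
  have hcardL : l ≤ aL → (Q.card : ℝ) < s ^ 2 * P.card := by
    intro hal
    have har : r < aL := (hside aL (by simp)).resolve_right (by linarith)
    refine card_lt_of_sum_mass (by positivity) hmass fun x hx => ?_
    unfold mass
    rw [if_pos ((Finset.mem_filter.mp hx).2.2.trans_lt har)]
    split_ifs <;> linarith
  have hmean := mean_mem_Icc hBne hB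
  have houter : (Q.card : ℝ) < s ^ 2 * P.card → (∀ q ∈ Set.Icc l r, τ₀ ≤ |q - c₀|) →
      |∑ p ∈ B, (tent c τ p - tent c τ (mean B))| ≤
        12 * s ^ 2 * (P.card * U + P.card * |c - c₀|) := by
    intro hq hfar
    have hτ' : τ ≤ τ₀ + |c - c₀| := by linarith [(abs_le.mp hτ).2]
    have h₁ := abs_sum_sub_mean_le (B := B) (g := tent c τ) fun p hp =>
      abs_tent_sub_le_of_far hτ' (hfar p (hB p hp)) (hfar _ hmean)
    have h₂ : (B.card : ℝ) * (2 * |c - c₀|) ≤ (2 * (s ^ 2 * P.card)) * (2 * |c - c₀|) :=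
      mul_le_mul_of_nonneg_right (by linarith) (by linarith)
    linarith [mul_nonneg hs2.le hnR, mul_nonneg hs2.le hnU]
  rcases hside (c₀ - τ₀) (by simp) with h₁ | h₁
  · refine houter (hcardL (by linarith)) fun q hq => ?_
    linarith [neg_abs_le (q - c₀), hq.2]
  rcases hside (c₀ + τ₀) (by simp) with h₂ | h₂
  swap
  · refine houter (hcardR (by linarith)) fun q hq => ?_
    linarith [le_abs_self (q - c₀), hq.1]
  have hfar : U ≤ 4 * s ^ 2 * |c - c₀| →
      |∑ p ∈ B, (tent c τ p - tent c τ (mean B))| ≤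
        12 * s ^ 2 * (P.card * U + P.card * |c - c₀|) := by
    intro h₃
    have h₄ := abs_sum_tent_le_sum_abs hBne c τ c₀
    have h₅ : ∑ p ∈ B, |p - c₀| ≤ ∑ p ∈ P.filter (fun p => |p - c₀| < τ₀), |p - c₀| := by
      refine Finset.sum_le_sum_of_subset_of_nonneg (fun p hp => ?_) fun _ _ _ => abs_nonneg _
      rw [Finset.mem_filter, abs_lt]
      exact ⟨hBP hp, by linarith [(hB p hp).1], by linarith [(hB p hp).2]⟩
    linarith [mul_nonneg hs2.le hnR, mul_nonneg hs2.le hnU, mul_le_mul_of_nonneg_left h₃ hn.le]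
  have hcore := abs_sum_tent_le_card_mul hBne hB c τ
  have hlen : 0 ≤ r - l := by linarith
  have hedge : ∀ α ∈ ({c₀, c₀ - τ₀, c₀ + τ₀} : Set ℝ), ∀ z ∈ Set.Icc l r,
      |z - α| ≤ 2 * |c - c₀| → (Q.card : ℝ) < s ^ 2 * P.card →
      |∑ p ∈ B, (tent c τ p - tent c τ (mean B))| ≤
        12 * s ^ 2 * (P.card * U + P.card * |c - c₀|) := by
    intro α hα z hzI hzα hq
    have hα' : α ∈ ({c₀, c₀ - τ₀, c₀ + τ₀, aL, aR} : Set ℝ) := by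
      rcases hα with (rfl | rfl | rfl) <;> simp
    rcases sub_le_or_le_of_logPos hU hs hs' hlr (hside α hα') (hlog α hα) with h₃ | h₃
    · have h₄ := h₃ z hzI
      have h₅ : r - l ≤ U + 2 * |c - c₀| := by
        have : 2 * s * (U + |z - α|) ≤ 1 * (U + |z - α|) :=
          mul_le_mul_of_nonneg_right (by linarith) (by positivity)
        linarith
      have h₆ : (B.card : ℝ) * (r - l) ≤ (2 * (s ^ 2 * P.card)) * (U + 2 * |c - c₀|) :=
        mul_le_mul (by linarith) h₅ hlen (by positivity)
      linarith [mul_nonneg hs2.le hnR, mul_nonneg hs2.le hnU]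
    · refine hfar ((h₃ z hzI).trans ?_)
      nlinarith
  have hτ₁ := (abs_le.mp hτ).1
  have hτ₂ := (abs_le.mp hτ).2
  rcases hz with hz | hz | hz
  · rcases sub_le_or_le_of_logPos hU hs hs' hlr (hside c₀ (by simp)) (hlog c₀ (by simp))
      with h₃ | h₃
    · have h₄ := h₃ c hz
      have h₅ : (B.card : ℝ) * (r - l) ≤ (2 * (s * P.card)) * (2 * s * (U + |c - c₀|)) :=
        mul_le_mul (by linarith) h₄ hlen (by positivity)
      linarith [mul_nonneg hs2.le hnR, mul_nonneg hs2.le hnU]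
    · refine hfar ((h₃ c hz).trans ?_)
      nlinarith
  · refine hedge (c₀ - τ₀) (by simp) _ hz ?_ (hcardL (hzL hz))
    rw [abs_le]
    constructor <;> linarith [neg_abs_le (c - c₀), le_abs_self (c - c₀)]
  · refine hedge (c₀ + τ₀) (by simp) _ hz ?_ (hcardR (hzR hz))
    rw [abs_le]
    constructor <;> linarith [neg_abs_le (c - c₀), le_abs_self (c - c₀)]

/-- Replaces a point by the mean of its bucket in `P`, the buckets being the fibres of `K`. -/
noncomputable def bucketMean (P : Finset ℝ) (K : ℝ → ℕ) (p : ℝ) : ℝ :=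
  mean (P.filter fun q => K q = K p)

theorem card_image_bucketMean_le {P : Finset ℝ} {K : ℝ → ℕ} {N : ℝ} (hN : ∀ q, (K q : ℝ) ≤ N) :
    ((P.image (bucketMean P K)).card : ℝ) ≤ N + 1 := by
  have hN0 : 0 ≤ N := (Nat.cast_nonneg _).trans (hN 0)
  have himage : P.image (bucketMean P K) =
      (P.image K).image fun j => mean (P.filter fun q => K q = j) := by
    rw [Finset.image_image]
    rfl
  have hsub : P.image K ⊆ Finset.range (⌊N⌋₊ + 1) := by
    intro j hj
    obtain ⟨q, -, rfl⟩ := Finset.mem_image.mp hj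
    exact Finset.mem_range_succ_iff.mpr (Nat.le_floor (hN q))
  have hcard : (P.image (bucketMean P K)).card ≤ ⌊N⌋₊ + 1 := by
    rw [himage, ← Finset.card_range (⌊N⌋₊ + 1)]
    exact Finset.card_image_le.trans (Finset.card_le_card hsub)
  calc ((P.image (bucketMean P K)).card : ℝ) ≤ ((⌊N⌋₊ + 1 : ℕ) : ℝ) := Nat.cast_le.mpr hcard
    _ ≤ N + 1 := by
      push_cast
      linarith [Nat.floor_le hN0]

/-- Each point of `Z` lies in the hull of at most one bucket, so if the error vanishes on the other
buckets and is at most `η` on these, then the total error is at most `|Z| η`. -/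
theorem abs_sum_bucketMean_le {P : Finset ℝ} {K : ℝ → ℕ} (hK : Monotone K) (Z : Finset ℝ)
    (g : ℝ → ℝ) {η : ℝ} (hη : 0 ≤ η)
    (hbad : ∀ j, ∀ l ∈ P.filter (fun q => K q = j), ∀ r ∈ P.filter (fun q => K q = j),
      (∀ p ∈ P.filter (fun q => K q = j), p ∈ Set.Icc l r) → (∃ z ∈ Z, z ∈ Set.Icc l r) →
      |∑ p ∈ P.filter (fun q => K q = j), (g p - g (mean (P.filter fun q => K q = j)))| ≤ η)
    (hgood : ∀ j, ∀ l ∈ P.filter (fun q => K q = j), ∀ r ∈ P.filter (fun q => K q = j),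
      (∀ p ∈ P.filter (fun q => K q = j), p ∈ Set.Icc l r) → (∀ z ∈ Z, z ∉ Set.Icc l r) →
      ∑ p ∈ P.filter (fun q => K q = j), (g p - g (mean (P.filter fun q => K q = j))) = 0) :
    |∑ p ∈ P, (g p - g (bucketMean P K p))| ≤ Z.card * η := by
  set F : ℕ → ℝ := fun j =>
    ∑ p ∈ P.filter (fun q => K q = j), (g p - g (mean (P.filter fun q => K q = j))) with hF
  have hsum : ∑ p ∈ P, (g p - g (bucketMean P K p)) = ∑ j ∈ P.image K, F j := by
    rw [← Finset.sum_fiberwise_of_maps_to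
      (fun p hp => Finset.mem_image_of_mem K hp : ∀ p ∈ P, K p ∈ P.image K)]
    refine Finset.sum_congr rfl fun j _ => Finset.sum_congr rfl fun p hp => ?_
    rw [bucketMean, (Finset.mem_filter.mp hp).2]
  set hit : ℝ → Finset ℕ := fun z => (P.image K).filter fun j =>
    ∃ p ∈ P, ∃ q ∈ P, K p = j ∧ K q = j ∧ p ≤ z ∧ z ≤ q with hhit
  have hhit_card : ∀ z, (hit z).card ≤ 1 := by
    intro z
    rw [Finset.card_le_one]
    intro j hj j' hj'
    obtain ⟨-, p, -, q, -, hpj, hqj, hpz, hzq⟩ := Finset.mem_filter.mp hj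
    obtain ⟨-, p', -, q', -, hpj', hqj', hpz', hzq'⟩ := Finset.mem_filter.mp hj'
    have h₁ := hK (hpz.trans hzq')
    have h₂ := hK (hpz'.trans hzq)
    omega
  have hminmax : ∀ j ∈ P.image K, ∃ l ∈ P.filter (fun q => K q = j),
      ∃ r ∈ P.filter (fun q => K q = j), ∀ p ∈ P.filter (fun q => K q = j), p ∈ Set.Icc l r := by
    intro j hj
    obtain ⟨q, hq, hqj⟩ := Finset.mem_image.mp hj
    have hne : (P.filter fun q => K q = j).Nonempty := ⟨q, Finset.mem_filter.mpr ⟨hq, hqj⟩⟩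
    exact ⟨_, Finset.min'_mem _ hne, _, Finset.max'_mem _ hne,
      fun p hp => ⟨Finset.min'_le _ _ hp, Finset.le_max' _ _ hp⟩⟩
  have hzero : ∀ j ∈ P.image K, j ∉ Z.biUnion hit → F j = 0 := by
    intro j hj hjZ
    obtain ⟨l, hl, r, hr, hlr⟩ := hminmax j hj
    refine hgood j l hl r hr hlr fun z hz hzI => hjZ ?_
    rw [Finset.mem_filter] at hl hr
    exact Finset.mem_biUnion.mpr ⟨z, hz, Finset.mem_filter.mpr
      ⟨hj, l, hl.1, r, hr.1, hl.2, hr.2, hzI.1, hzI.2⟩⟩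
  have hle : ∀ j ∈ Z.biUnion hit, |F j| ≤ η := by
    intro j hj
    obtain ⟨z, hz, hjz⟩ := Finset.mem_biUnion.mp hj
    obtain ⟨hj', p, hp, q, hq, hpj, hqj, hpz, hzq⟩ := Finset.mem_filter.mp hjz
    obtain ⟨l, hl, r, hr, hlr⟩ := hminmax j hj'
    exact hbad j l hl r hr hlr ⟨z, hz, (hlr p (Finset.mem_filter.mpr ⟨hp, hpj⟩)).1.trans hpz,
      hzq.trans (hlr q (Finset.mem_filter.mpr ⟨hq, hqj⟩)).2⟩
  have hsub : Z.biUnion hit ⊆ P.image K :=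
    Finset.biUnion_subset.mpr fun z _ => Finset.filter_subset _ _
  rw [hsum, ← Finset.sum_subset hsub hzero]
  refine (Finset.abs_sum_le_sum_abs _ _).trans ((Finset.sum_le_card_nsmul _ _ η hle).trans ?_)
  rw [nsmul_eq_mul]
  refine mul_le_mul_of_nonneg_right (Nat.cast_le.mpr ?_) hη
  simpa using Finset.card_biUnion_le_card_mul Z hit 1 fun z _ => hhit_card z

/-- `f` does not move points of `P` across `a`. -/
def Respects (P : Finset ℝ) (f : ℝ → ℝ) (a : ℝ) : Prop :=
  ∀ p ∈ P, (p < a → f p < a) ∧ (p = a → f p = a) ∧ (a < p → a < f p)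

theorem respects_id (P : Finset ℝ) (a : ℝ) : Respects P (fun p => p) a :=
  fun _ _ => ⟨id, id, id⟩

theorem Respects.lt_iff {P : Finset ℝ} {f : ℝ → ℝ} {a p : ℝ} (h : Respects P f a) (hp : p ∈ P) :
    f p < a ↔ p < a := by
  obtain ⟨h₁, h₂, h₃⟩ := h p hp
  refine ⟨fun hlt => ?_, h₁⟩
  by_contra! hge
  rcases hge.eq_or_lt with h | h
  · linarith [h₂ h.symm]
  · linarith [h₃ h]

theorem Respects.gt_iff {P : Finset ℝ} {f : ℝ → ℝ} {a p : ℝ} (h : Respects P f a) (hp : p ∈ P) :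
    a < f p ↔ a < p := by
  obtain ⟨h₁, h₂, h₃⟩ := h p hp
  refine ⟨fun hlt => ?_, h₃⟩
  by_contra! hge
  rcases hge.eq_or_lt with h | h
  · linarith [h₂ h]
  · linarith [h₁ h]

theorem respects_bucketMean {P : Finset ℝ} {K : ℝ → ℕ} {a : ℝ}
    (h : ∀ p q, p < q → K p = K q → q < a ∨ a < p) : Respects P (bucketMean P K) a := by
  intro p hp
  have hne : (P.filter fun q => K q = K p).Nonempty := ⟨p, Finset.mem_filter.mpr ⟨hp, rfl⟩⟩
  have hmem : ∀ q ∈ P.filter (fun q => K q = K p), q ∈ Set.Icc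
      ((P.filter fun q => K q = K p).min' hne) ((P.filter fun q => K q = K p).max' hne) :=
    fun q hq => ⟨Finset.min'_le _ _ hq, Finset.le_max' _ _ hq⟩
  have hmean := mean_mem_Icc hne hmem
  have hKmin := (Finset.mem_filter.mp (Finset.min'_mem _ hne)).2
  have hKmax := (Finset.mem_filter.mp (Finset.max'_mem _ hne)).2
  have hp' := hmem p (Finset.mem_filter.mpr ⟨hp, rfl⟩)
  refine ⟨fun hpa => ?_, fun hpa => ?_, fun hpa => ?_⟩
  · refine hmean.2.trans_lt ?_
    rcases hp'.2.eq_or_lt with h₁ | h₁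
    · exact h₁.symm.trans_lt hpa
    · exact (h _ _ h₁ hKmax.symm).resolve_right (by linarith)
  · refine le_antisymm (hmean.2.trans ?_) (le_trans ?_ hmean.1)
    · by_contra! hlt
      rcases h _ _ (hpa ▸ hlt : p < _) hKmax.symm with h₁ | h₁ <;> linarith
    · by_contra! hlt
      rcases h _ _ (hpa ▸ hlt : _ < p) hKmin with h₁ | h₁ <;> linarith
  · refine lt_of_lt_of_le ?_ hmean.1
    rcases hp'.1.eq_or_lt with h₁ | h₁
    · exact hpa.trans_eq h₁.symm
    · exact (h _ _ h₁ hKmin).resolve_left (by linarith)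

theorem IsLevel.of_respects {P : Finset ℝ} {f : ℝ → ℝ} {k : ℕ} {c τ : ℝ}
    (h : IsLevel P (fun p => |p - c|) k τ) (hl : Respects P f (c - τ))
    (hr : Respects P f (c + τ)) : IsLevel P (fun p => |f p - c|) k τ := by
  have h₁ : (P.filter fun p => |f p - c| < τ) = P.filter fun p => |p - c| < τ := by
    refine Finset.filter_congr fun p hp => ?_
    have h₂ := hl.gt_iff hp
    have h₃ := hr.lt_iff hp
    rw [abs_lt, abs_lt]
    constructor
    · rintro ⟨h₄, h₅⟩
      exact ⟨by linarith [h₂.mp (by linarith)], by linarith [h₃.mp (by linarith)]⟩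
    · rintro ⟨h₄, h₅⟩
      exact ⟨by linarith [h₂.mpr (by linarith)], by linarith [h₃.mpr (by linarith)]⟩
  have h₁' : (P.filter fun p => |f p - c| ≤ τ) = P.filter fun p => |p - c| ≤ τ := by
    refine Finset.filter_congr fun p hp => ?_
    have h₂ := not_congr (hl.lt_iff hp)
    have h₃ := not_congr (hr.gt_iff hp)
    rw [not_lt, not_lt] at h₂ h₃
    rw [abs_le, abs_le]
    constructor
    · rintro ⟨h₄, h₅⟩
      exact ⟨by linarith [h₂.mp (by linarith)], by linarith [h₃.mp (by linarith)]⟩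
    · rintro ⟨h₄, h₅⟩
      exact ⟨by linarith [h₂.mpr (by linarith)], by linarith [h₃.mpr (by linarith)]⟩
  rw [IsLevel, h₁, h₁']
  exact h

theorem IsLevel.card_le {P T : Finset ℝ} {d : ℝ → ℝ} {m : ℕ} {τ : ℝ} (hm : m < P.card)
    (h : IsLevel P d (P.card - m) τ) (hT : T ⊆ P) (hfar : ∀ p ∈ T, τ < d p) : T.card ≤ m := by
  have h₁ : T ⊆ P.filter fun p => ¬ d p ≤ τ := fun p hp =>
    Finset.mem_filter.mpr ⟨hT hp, not_le.mpr (hfar p hp)⟩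
  have h₂ := Finset.card_le_card h₁
  have h₃ := Finset.card_filter_add_card_filter_not (s := P) (fun p => d p ≤ τ)
  have h₄ := h.2
  omega

theorem IsLevel.le_add_of_card {P : Finset ℝ} {f : ℝ → ℝ} {m : ℕ} {a c τ : ℝ}
    (hm : m < P.card) (h : IsLevel P (fun p => |f p - c|) (P.card - m) τ) (hf : Respects P f a)
    (ha : a ∈ P) (hcard : (P.filter fun p => a < p).card = m) : a ≤ c + τ := by
  by_contra! hlt
  have := h.card_le hm (T := insert a (P.filter fun p => a < p))
    (Finset.insert_subset ha (Finset.filter_subset _ _)) (fun p hp => ?_)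
  · rw [Finset.card_insert_of_notMem (by simp), hcard] at this
    omega
  · have h₁ : a ≤ f p := by
      rcases Finset.mem_insert.mp hp with rfl | hp
      · exact ((hf p ha).2.1 rfl).ge
      · rw [Finset.mem_filter] at hp
        exact ((hf p hp.1).2.2 hp.2).le
    linarith [le_abs_self (f p - c)]

theorem IsLevel.sub_le_of_card {P : Finset ℝ} {f : ℝ → ℝ} {m : ℕ} {a c τ : ℝ}
    (hm : m < P.card) (h : IsLevel P (fun p => |f p - c|) (P.card - m) τ) (hf : Respects P f a)
    (ha : a ∈ P) (hcard : (P.filter fun p => p < a).card = m) : c - τ ≤ a := by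
  by_contra! hlt
  have := h.card_le hm (T := insert a (P.filter fun p => p < a))
    (Finset.insert_subset ha (Finset.filter_subset _ _)) (fun p hp => ?_)
  · rw [Finset.card_insert_of_notMem (by simp), hcard] at this
    omega
  · have h₁ : f p ≤ a := by
      rcases Finset.mem_insert.mp hp with rfl | hp
      · exact ((hf p ha).2.1 rfl).le
      · rw [Finset.mem_filter] at hp
        exact ((hf p hp.1).1 hp.2).le
    linarith [neg_abs_le (f p - c)]

theorem exists_card_filter_gt {P : Finset ℝ} {k : ℕ} (hk : k < P.card) :
    ∃ a ∈ P, (P.filter fun p => p < a).card = k := by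
  obtain ⟨a, ha, hcard⟩ := exists_card_filter_lt (P := P) (k := P.card - 1 - k) (by omega)
  refine ⟨a, ha, ?_⟩
  have hsplit := Finset.card_filter_add_card_filter_not (s := P) (fun p => a < p)
  have hins : (P.filter fun p => ¬ a < p) = insert a (P.filter fun p => p < a) := by
    ext p
    simp only [Finset.mem_filter, Finset.mem_insert, not_lt, le_iff_eq_or_lt]
    constructor
    · tauto
    · rintro (rfl | h) <;> tauto
  rw [hins, Finset.card_insert_of_notMem (by simp)] at hsplit
  omega

theorem rcost_pos {m : ℕ} {P : Finset ℝ} {c : ℝ} (hc : c ∈ P) (hm : m + 2 ≤ P.card) :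
    0 < rcost m P c := by
  have hcard := Finset.card_erase_of_mem hc
  have hne : (P.erase c).Nonempty := Finset.card_pos.mp (by omega)
  obtain ⟨q, hq, hmin⟩ := Finset.exists_min_image (P.erase c) (fun p => |p - c|) hne
  have hpos : 0 < |q - c| := abs_pos.mpr (sub_ne_zero.mpr (Finset.ne_of_mem_erase hq))
  have h := mul_le_rcost (m := m) (by omega) (Finset.erase_subset c P) (abs_nonneg (q - c)) hmin
    (x := 1) (by rw [hcard]; exact_mod_cast (by omega : 1 + m ≤ P.card - 1))
  linarith

theorem exists_bucketing {P : Finset ℝ} {m : ℕ} (hm : 1 ≤ m) (hmP : 4 * m ≤ P.card) {s : ℝ}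
    (hs : 0 < s) (hs' : s ≤ 1 / 10) :
    ∃ K : ℝ → ℕ,
      (∀ q, (K q : ℝ) ≤
        10 + 6 * Real.log (1 + 1 / s ^ 2) / s + 2 * (m / P.card) / s ^ 2 + 1 / s) ∧
      ∀ c, |wrcost ((P.card : ℝ) - m) (P.image (bucketMean P K)) (pushWeight P (bucketMean P K)) c -
        rcost m P c| ≤ 324 * s ^ 2 * rcost m P c := by
  have hmP' : m < P.card := by omega
  have hP : P.Nonempty := Finset.card_pos.mp (by omega)
  have hn : (0 : ℝ) < P.card := Nat.cast_pos.mpr (Finset.card_pos.mpr hP)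
  have hs2 : 0 < s ^ 2 := by positivity
  obtain ⟨c₀, hc₀, hmed⟩ := exists_card_filter_lt (P := P) (k := P.card / 2) (by omega)
  obtain ⟨aR, haR, hcardR⟩ := exists_card_filter_lt (P := P) (k := m) (by omega)
  obtain ⟨aL, haL, hcardL⟩ := exists_card_filter_gt (P := P) (k := m) (by omega)
  obtain ⟨τ₀, hτ₀⟩ := exists_isLevel (P := P) (fun p => |p - c₀|) (k := P.card - m)
    (by omega) (Nat.sub_le _ _)
  set U : ℝ := rcost m P c₀ / P.card with hUdef
  have hU : 0 < U := div_pos (rcost_pos hc₀ (by omega)) hn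
  have hnU : P.card * U = rcost m P c₀ := mul_div_cancel₀ _ hn.ne'
  set Ψ := potential P c₀ τ₀ aL aR U s with hΨ
  set K : ℝ → ℕ := fun q => ⌊Ψ q⌋₊ with hK
  have hΨ0 : ∀ q, 0 ≤ Ψ q := potential_nonneg hU hs
  have hKmono : Monotone K := fun p q hpq => Nat.floor_le_floor (potential_mono hU hs hpq)
  have hclose : ∀ p q, K p = K q → Ψ q - Ψ p < 1 := by
    intro p q hpq
    have h₁ : Ψ q < K q + 1 := Nat.lt_floor_add_one _
    have h₂ : (K p : ℝ) ≤ Ψ p := Nat.floor_le (hΨ0 p)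
    rw [hpq] at h₂
    linarith
  have hresp : ∀ a ∈ ({c₀, c₀ - τ₀, c₀ + τ₀, aL, aR} : Set ℝ), Respects P (bucketMean P K) a :=
    fun a ha => respects_bucketMean fun p q hpq hKpq =>
      same_side_of_cut hpq ((close_of_potential hU hs hpq.le (hclose p q hKpq)).1 a ha)
  have hinside : ∑ p ∈ P.filter (fun p => |p - c₀| < τ₀), |p - c₀| ≤ P.card * U := by
    obtain ⟨I, hI, -, hin, hsum⟩ := hτ₀.exists_subset
    rw [Nat.cast_sub hmP'.le] at hsum
    rw [hnU]
    refine le_trans ?_ (hsum.le.trans (dual_le_rcost hmP'.le c₀ τ₀))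
    refine Finset.sum_le_sum_of_subset_of_nonneg (fun p hp => ?_) fun _ _ _ => abs_nonneg _
    exact hin p (Finset.mem_filter.mp hp).1 (Finset.mem_filter.mp hp).2
  refine ⟨K, fun q => (Nat.floor_le (hΨ0 q)).trans (potential_le hU hs hP hcardL hcardR q),
    fun c => abs_wrcost_sub_rcost_le hmP' fun τ hτ => ?_⟩
  obtain ⟨f, hf, hfresp⟩ : ∃ f : ℝ → ℝ, IsLevel P (fun p => |f p - c|) (P.card - m) τ ∧
      ∀ a ∈ ({c₀, c₀ - τ₀, c₀ + τ₀, aL, aR} : Set ℝ), Respects P f a := by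
    rcases hτ with hτ | hτ
    · exact ⟨fun p => p, hτ, fun a _ => respects_id P a⟩
    · exact ⟨_, hτ, hresp⟩
  have hfτ₀ : IsLevel P (fun p => |f p - c₀|) (P.card - m) τ₀ :=
    hτ₀.of_respects (hfresp _ (by simp)) (hfresp _ (by simp))
  have hττ₀ : |τ - τ₀| ≤ |c - c₀| := by
    have h₁ : τ ≤ τ₀ + |c - c₀| := hfτ₀.le_add hf fun p _ => by
      rw [abs_sub_comm c c₀]
      exact abs_sub_le _ _ _
    have h₂ : τ₀ ≤ τ + |c - c₀| := hf.le_add hfτ₀ fun p _ => abs_sub_le _ _ _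
    rw [abs_le]
    constructor <;> linarith
  have haR' := hf.le_add_of_card hmP' (hfresp aR (by simp)) haR hcardR
  have haL' := hf.sub_le_of_card hmP' (hfresp aL (by simp)) haL hcardL
  have haR₀ := hfτ₀.le_add_of_card hmP' (hfresp aR (by simp)) haR hcardR
  have haL₀ := hfτ₀.sub_le_of_card hmP' (hfresp aL (by simp)) haL hcardL
  have hη : 0 ≤ 12 * s ^ 2 * (P.card * U + P.card * |c - c₀|) := by positivity
  have herr := abs_sum_bucketMean_le hKmono (P := P) {c, c - τ, c + τ} (tent c τ) hη ?_ ?_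
  · have hZ : ((({c, c - τ, c + τ} : Finset ℝ).card : ℕ) : ℝ) ≤ 3 := by
      exact_mod_cast Finset.card_le_three
    have h₁ := mul_le_mul_of_nonneg_right hZ hη
    have h₂ := card_mul_abs_le_rcost hmP hc₀ hmed c
    have h₃ := rcost_le_add hmP'.le c c₀
    have h₄ : P.card * U + P.card * |c - c₀| ≤ 9 * rcost m P c := by linarith
    have h₅ := mul_le_mul_of_nonneg_left h₄ hs2.le
    refine (herr.trans h₁).trans ?_
    linarith
  · rintro j l hl r hr hB ⟨z, hzZ, hz⟩
    rcases (hB l hl).2.eq_or_lt with hlr | hlr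
    · subst hlr
      have hne : (P.filter fun q => K q = j).Nonempty := ⟨l, hl⟩
      have h₁ := abs_sum_tent_le_card_mul hne hB c τ
      rw [sub_self, mul_zero] at h₁
      exact h₁.trans hη
    · refine abs_sum_tent_sub_mean_le hU hs hs' hl hr hlr (Finset.filter_subset _ _) hB
        (hclose l r ?_) hinside hττ₀ haR₀ haL₀ (fun h => haR'.trans h.2) (fun h => h.1.trans haL') ?_
      · rw [(Finset.mem_filter.mp hl).2, (Finset.mem_filter.mp hr).2]
      · simp only [Finset.mem_insert, Finset.mem_singleton] at hzZ
        rcases hzZ with rfl | rfl | rfl <;> tauto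
  · intro j l hl r hr hB hZ
    obtain ⟨a, b, hab⟩ := tent_affine (hZ (c - τ) (by simp)) (hZ c (by simp)) (hZ (c + τ) (by simp))
    exact sum_sub_mean_eq_zero_of_affine ⟨l, hl⟩ hB hab

theorem log_one_add_le {ε : ℝ} (hε : 0 < ε) (hε' : ε < 1) :
    Real.log (1 + 400 / ε) ≤ 9 + Real.log (1 / ε) := by
  have h₁ : 1 + 400 / ε ≤ 2 ^ 9 * (1 / ε) := by
    rw [mul_one_div, ← sub_nonneg]
    have : 2 ^ 9 / ε - (1 + 400 / ε) = (112 - ε) / ε := by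
      field_simp
      ring
    rw [this]
    exact div_nonneg (by linarith) hε.le
  have h₂ := Real.log_le_log (by positivity) h₁
  rw [Real.log_mul (by positivity) (by positivity), Real.log_pow] at h₂
  have h₃ := Real.log_two_lt_d9
  push_cast at h₂
  linarith

theorem le_rpow_of_one_le {x a : ℝ} (hx : 1 ≤ x) (ha : 1 ≤ a) : x ≤ x ^ a := by
  conv_lhs => rw [← Real.rpow_one x]
  exact Real.rpow_le_rpow_of_exponent_le hx ha

theorem size_bound_le {x y L M z : ℝ} (hx : 1 ≤ x) (hy : 0 ≤ y) (hL : 0 ≤ L) (hM : M ≤ 9 + L)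
    (hz : 1 + L ≤ z) : 10 + 120 * (x * M) + 800 * y + 20 * x + 1 ≤ 1200 * (x + y) * z := by
  have h₁ := mul_le_mul_of_nonneg_left hM (by linarith : 0 ≤ x)
  have h₂ := mul_le_mul_of_nonneg_left hz (by linarith : 0 ≤ 1200 * (x + y))
  linarith [mul_nonneg (by linarith : 0 ≤ x) hL, mul_nonneg hy hL]

/-- **Optimal coreset for robust 1D geometric median (upper bound).**
There is an absolute constant `C > 0` such that for all `n ≥ 4m ≥ 4` and
`ε ∈ (0,1)`, every set of `n` distinct reals admits an `ε`-coreset for the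
robust geometric median problem with `m` outliers of size at most
`C · (ε^{-1/2} + (m/n) · ε^{-1}) · (1 + log(1/ε))^C`. -/
theorem robust_median_1d_coreset_upper_bound :
    ∃ C : ℝ, 0 < C ∧
      ∀ (n m : ℕ) (ε : ℝ) (P : Finset ℝ),
        1 ≤ m → 4 * m ≤ n → 0 < ε → ε < 1 → P.card = n →
        ∃ (S : Finset ℝ) (w : ℝ → ℝ),
          (∀ p ∈ S, 0 < w p) ∧
          (∑ p ∈ S, w p) = (n : ℝ) ∧
          (∀ c : ℝ,
            (1 - ε) * rcost m P c ≤ wrcost ((n : ℝ) - m) S w c ∧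
            wrcost ((n : ℝ) - m) S w c ≤ (1 + ε) * rcost m P c) ∧
          (S.card : ℝ) ≤
            C * (ε ^ (-(1 : ℝ) / 2) + ((m : ℝ) / n) * ε⁻¹) *
              (1 + Real.log (1 / ε)) ^ C := by
  refine ⟨1200, by norm_num, fun n m ε P hm hmn hε hε' hP => ?_⟩
  subst hP
  have hsqrt : 0 < √ε := Real.sqrt_pos.mpr hε
  have hsqrt' : √ε ≤ 1 := Real.sqrt_le_one.mpr hε'.le
  have hs2 : (√ε / 20) ^ 2 = ε / 400 := by
    rw [div_pow, Real.sq_sqrt hε.le]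
    norm_num
  obtain ⟨K, hK, herr⟩ := exists_bucketing hm hmn (s := √ε / 20) (by positivity) (by linarith)
  refine ⟨P.image (bucketMean P K), pushWeight P (bucketMean P K), fun p hp => ?_,
    sum_pushWeight P P (Finset.Subset.refl P) _, fun c => ?_, ?_⟩
  · obtain ⟨q, hq, rfl⟩ := Finset.mem_image.mp hp
    exact Nat.cast_pos.mpr (Finset.card_pos.mpr ⟨q, Finset.mem_filter.mpr ⟨hq, rfl⟩⟩)
  · have h₁ := herr c
    have h₂ : 0 ≤ rcost m P c := le_rcost (by omega) fun I _ _ =>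
      Finset.sum_nonneg fun _ _ => abs_nonneg _
    rw [hs2, abs_le] at h₁
    have h₃ : 0 ≤ ε * rcost m P c := mul_nonneg hε.le h₂
    constructor <;> linarith
  · have hcard := card_image_bucketMean_le (P := P) hK
    rw [hs2, one_div_div, one_div_div] at hcard
    have hlog0 : 0 ≤ Real.log (1 / ε) := Real.log_nonneg (by rw [le_div_iff₀ hε]; linarith)
    have hlog := log_one_add_le hε hε'
    have hpow : ε ^ (-(1 : ℝ) / 2) = (√ε)⁻¹ := by
      rw [Real.sqrt_eq_rpow, ← Real.rpow_neg hε.le]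
      norm_num
    have hrpow := le_rpow_of_one_le (by linarith : 1 ≤ 1 + Real.log (1 / ε))
      (by norm_num : (1 : ℝ) ≤ 1200)
    have hx : 1 ≤ (√ε)⁻¹ := (one_le_inv₀ hsqrt).mpr hsqrt'
    have hy : 0 ≤ (m : ℝ) / P.card * ε⁻¹ := by positivity
    rw [hpow]
    set x := (√ε)⁻¹ with hxdef
    set y := (m : ℝ) / P.card * ε⁻¹ with hydef
    have h₁ : 6 * Real.log (1 + 400 / ε) / (√ε / 20) = 120 * (x * Real.log (1 + 400 / ε)) := by
      rw [hxdef]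
      field_simp
      ring
    have h₂ : 2 * ((m : ℝ) / P.card) / (ε / 400) = 800 * y := by
      rw [hydef]
      field_simp
      ring
    have h₃ : 20 / √ε = 20 * x := div_eq_mul_inv _ _
    rw [h₁, h₂, h₃] at hcard
    exact hcard.trans (size_bound_le hx hy hlog0 hlog hrpow)
end

section
/- For every real ε ∈ (0,1) and all integers n, m with n ≥ 4m, m ≥ 2 and n·ε > 1, there exists a dataset p : {1,…,n} → ℝ (points may coincide) such that every ε-coreset of this dataset for the robust geometric median problem with m outliers has size at least ⌊m/(2nε)⌋. -/
open Finset
open scoped Classical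

/-- Keeping any `n - m` data points bounds the robust cost from above. -/
theorem rcostIdx_le_sum {n m : ℕ} (hmn : m ≤ n) (p : Fin n → ℝ) (c : ℝ) (T : Finset (Fin n))
    (hT : T.card = n - m) : rcostIdx m p c ≤ ∑ i ∈ T, |p i - c| := by
  refine csInf_le ⟨0, ?_⟩ ⟨Tᶜ, ?_, by rw [compl_compl]⟩
  · rintro y ⟨L, -, rfl⟩
    exact Finset.sum_nonneg fun i _ => abs_nonneg _
  · rw [Finset.card_compl, Fintype.card_fin, hT]
    omega

/-- If every point of `S` is at distance at least `r` from `c`, then the weighted robust cost of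
retained weight `t` at `c` is at least `t * r`. -/
theorem mul_le_wrcost {t r c : ℝ} {S : Finset ℝ} {w : ℝ → ℝ} (ht : 0 ≤ t)
    (hw : ∀ q ∈ S, 0 < w q) (htw : t ≤ ∑ q ∈ S, w q) (hpos : 0 < ∑ q ∈ S, w q)
    (hr : ∀ q ∈ S, r ≤ |q - c|) : t * r ≤ wrcost t S w c := by
  refine le_csInf ⟨_, fun q => t / (∑ q ∈ S, w q) * w q, fun q hq => ⟨?_, ?_⟩, ?_, rfl⟩ ?_
  · exact mul_nonneg (div_nonneg ht hpos.le) (hw q hq).le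
  · exact mul_le_of_le_one_left (hw q hq).le ((div_le_one hpos).2 htw)
  · rw [← Finset.mul_sum, div_mul_cancel₀ _ hpos.ne']
  · rintro y ⟨w', hw', rfl, rfl⟩
    rw [Finset.sum_mul]
    exact Finset.sum_le_sum fun q hq => mul_le_mul_of_nonneg_left (hr q hq) (hw' q hq).1

/-- The dataset with `s` points at each of `1, M, …, M ^ (k - 1)` and all other points at `0`. -/
noncomputable def geometricClusters (n k s : ℕ) (M : ℝ) (i : Fin n) : ℝ :=
  if (i : ℕ) < k * s then M ^ ((i : ℕ) / s) else 0

/-- Centering at a cluster, one may keep that cluster and `n - m - s` points at the origin. -/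
theorem rcostIdx_geometricClusters_le {n m k s j : ℕ} {M : ℝ} (hM : 0 ≤ M) (hj : j < k)
    (hks : k * s ≤ m) (hmn : m + s ≤ n) :
    rcostIdx m (geometricClusters n k s M) (M ^ j) ≤ ((n : ℝ) - m - s) * M ^ j := by
  have hjs : j * s + s ≤ k * s := by
    rw [← Nat.succ_mul]
    exact Nat.mul_le_mul_right s hj
  let A : Finset (Fin n) := (Finset.Ico (j * s) (j * s + s)).attachFin fun i hi => by
    rw [Finset.mem_Ico] at hi
    omega
  let B : Finset (Fin n) := (Finset.Ico (k * s) (k * s + (n - m - s))).attachFin fun i hi => by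
    rw [Finset.mem_Ico] at hi
    omega
  have hA : ∀ i ∈ A, j * s ≤ (i : ℕ) ∧ (i : ℕ) < j * s + s := fun i hi => by
    simpa [A] using hi
  have hB : ∀ i ∈ B, k * s ≤ (i : ℕ) := fun i hi =>
    (Finset.mem_Ico.1 ((Finset.mem_attachFin _).1 hi)).1
  have hAcard : A.card = s := by simp [A]
  have hBcard : B.card = n - m - s := by simp [B]
  have hAB : Disjoint A B := Finset.disjoint_left.2 fun i hiA hiB => by
    have := hA i hiA
    have := hB i hiB
    omega
  have hAsum : ∑ i ∈ A, |geometricClusters n k s M i - M ^ j| = 0 :=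
    Finset.sum_eq_zero fun i hi => by
      obtain ⟨h1, h2⟩ := hA i hi
      have hdiv : (i : ℕ) / s = j := Nat.div_eq_of_lt_le h1 (by rwa [Nat.succ_mul])
      simp [geometricClusters, hdiv, h2.trans_le hjs]
  have hBsum : ∑ i ∈ B, |geometricClusters n k s M i - M ^ j| = ((n : ℝ) - m - s) * M ^ j := by
    rw [Finset.sum_congr rfl fun i hi => show |geometricClusters n k s M i - M ^ j| = M ^ j by
        simp [geometricClusters, (hB i hi).not_gt, abs_of_nonneg hM],
      Finset.sum_const, hBcard, nsmul_eq_mul, Nat.cast_sub (by omega), Nat.cast_sub (by omega)]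
  calc rcostIdx m (geometricClusters n k s M) (M ^ j)
      ≤ ∑ i ∈ A ∪ B, |geometricClusters n k s M i - M ^ j| :=
        rcostIdx_le_sum (by omega) _ _ _ (by
          rw [Finset.card_union_of_disjoint hAB, hAcard, hBcard]
          omega)
    _ = ((n : ℝ) - m - s) * M ^ j := by
        rw [Finset.sum_union hAB, hAsum, hBsum, zero_add]

/-- A finite set meeting the interval of relative radius `1 - δ` around each of the first `k` powers
of `M` has at least `k` elements when `δ * M ≥ 2`. -/
theorem le_card_of_near_geometric {k : ℕ} {δ M : ℝ} {S : Finset ℝ} (hδ : 0 < δ)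
    (hM : 1 ≤ M) (hδM : 2 ≤ δ * M)
    (h : ∀ j < k, ∃ q ∈ S, |q - M ^ j| < (1 - δ) * M ^ j) : k ≤ S.card := by
  choose! f hfS hf using h
  have key : ∀ i < k, ∀ j < k, i < j → f i ≠ f j := by
    intro i hi j hj hij heq
    have h1 := (abs_lt.1 (hf i hi)).2
    have h2 := (abs_lt.1 (hf j hj)).1
    have hpos : 0 < M ^ i := pow_pos (by linarith) i
    have hpow : M ^ (i + 1) ≤ M ^ j := pow_le_pow_right₀ hM hij
    have h3 : δ * M ^ (i + 1) ≤ δ * M ^ j := mul_le_mul_of_nonneg_left hpow hδ.le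
    have h4 : 2 * M ^ i ≤ δ * M * M ^ i := mul_le_mul_of_nonneg_right hδM hpos.le
    have h5 : δ * M ^ (i + 1) = δ * M * M ^ i := by ring
    have h6 : 0 < δ * M ^ i := mul_pos hδ hpos
    linarith
  have hcard := Finset.card_le_card_of_injOn (s := Finset.range k) (t := S) f
    (fun i hi => hfS i (Finset.mem_range.1 hi)) (by
      intro i hi j hj heq
      have hi' : i < k := Finset.mem_range.1 hi
      have hj' : j < k := Finset.mem_range.1 hj
      by_contra hne
      rcases lt_or_gt_of_ne hne with hlt | hlt
      · exact key i hi' j hj' hlt heq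
      · exact key j hj' i hi' hlt heq.symm)
  rwa [Finset.card_range] at hcard

/-- **Coreset size lower bound `⌊m/(2nε)⌋` for robust 1D geometric median.**
For every `ε ∈ (0,1)` and integers `n ≥ 4m`, `m ≥ 2` with `n·ε > 1`, there is a
dataset `p : Fin n → ℝ` (points may coincide) such that any `ε`-coreset — a
finite weighted set `(S, w)` of positive weights of total weight `n` whose
weighted robust cost is within `1 ± ε` of the robust cost at every center —
satisfies `|S| ≥ ⌊m/(2nε)⌋`. -/
theorem robust_median_1d_lower_bound_floor
    (n m : ℕ) (ε : ℝ) (hm : 2 ≤ m) (hmn : 4 * m ≤ n)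
    (hε0 : 0 < ε) (hε1 : ε < 1) (hnε : 1 < (n : ℝ) * ε) :
    ∃ p : Fin n → ℝ,
      ∀ (S : Finset ℝ) (w : ℝ → ℝ),
        (∀ q ∈ S, 0 < w q) →
        (∑ q ∈ S, w q) = (n : ℝ) →
        (∀ c : ℝ,
          (1 - ε) * rcostIdx m p c ≤ wrcost ((n : ℝ) - m) S w c ∧
          wrcost ((n : ℝ) - m) S w c ≤ (1 + ε) * rcostIdx m p c) →
        ⌊(m : ℝ) / (2 * (n : ℝ) * ε)⌋ ≤ (S.card : ℤ) := by
  have hn : (0 : ℝ) < n := Nat.cast_pos.2 (by omega)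
  have hm0 : (0 : ℝ) < m := Nat.cast_pos.2 (by omega)
  have hmn' : 4 * (m : ℝ) ≤ n := by exact_mod_cast hmn
  have hden : 0 < 2 * (n : ℝ) * ε := by positivity
  obtain ⟨k, hk⟩ := Int.eq_ofNat_of_zero_le
    (Int.floor_nonneg.2 (div_nonneg hm0.le hden.le))
  rw [hk]
  obtain rfl | hk0 := Nat.eq_zero_or_pos k
  · exact ⟨fun _ => 0, fun S _ _ _ _ => by simp⟩
  have hkm : (k : ℝ) * (2 * n * ε) ≤ m := by
    rw [← le_div_iff₀ hden]
    have := Int.floor_le ((m : ℝ) / (2 * (n : ℝ) * ε))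
    rwa [hk] at this
  set s := m / k
  have hsm : s ≤ m := Nat.div_le_self m k
  have hnεs : (n : ℝ) * ε < s := by
    have h1 : (m : ℝ) < k * (s + 1) := by
      exact_mod_cast Nat.lt_mul_div_succ m hk0
    have hk' : (0 : ℝ) < k := Nat.cast_pos.2 hk0
    have h2 : 2 * (n : ℝ) * ε < s + 1 := lt_of_mul_lt_mul_left (hkm.trans_lt h1) hk'.le
    linarith
  set δ : ℝ := ε * m / n with hδ
  have hδ0 : 0 < δ := by positivity
  have hδn : δ * n = ε * m := div_mul_cancel₀ _ hn.ne'
  have hδ1 : δ ≤ 1 := by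
    rw [hδ, div_le_one hn]
    nlinarith
  have hδM : δ * (2 / δ) = 2 := mul_div_cancel₀ _ hδ0.ne'
  have hM : 1 ≤ 2 / δ := by
    rw [le_div_iff₀ hδ0]
    linarith
  refine ⟨geometricClusters n k s (2 / δ), fun S w hw hwn hcore => ?_⟩
  refine Int.ofNat_le.2 (le_card_of_near_geometric hδ0 hM hδM.ge fun j hj => ?_)
  by_contra! hfar
  have hpos : 0 < (2 / δ) ^ j := pow_pos (by linarith) j
  have hlower := mul_le_wrcost (t := (n : ℝ) - m) (by linarith) hw (by linarith) (by linarith) hfar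
  have hupper := rcostIdx_geometricClusters_le (n := n) (by linarith) hj
    (Nat.mul_div_le m k) (by omega : m + s ≤ n) (M := 2 / δ)
  have h1 : ((n : ℝ) - m) * (1 - δ) * (2 / δ) ^ j ≤
      (1 + ε) * ((n : ℝ) - m - s) * (2 / δ) ^ j := by
    calc ((n : ℝ) - m) * (1 - δ) * (2 / δ) ^ j
        = ((n : ℝ) - m) * ((1 - δ) * (2 / δ) ^ j) := by ring
      _ ≤ _ := hlower
      _ ≤ _ := (hcore _).2
      _ ≤ (1 + ε) * (((n : ℝ) - m - s) * (2 / δ) ^ j) :=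
          mul_le_mul_of_nonneg_left hupper (by linarith)
      _ = _ := by ring
  have h2 := le_of_mul_le_mul_right h1 hpos
  have h3 : 0 < δ * m := mul_pos hδ0 hm0
  have h4 : 0 < ε * s := mul_pos hε0 (by linarith)
  nlinarith
end
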